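/- The limit set of a finitely generated Fuchsian group of the second kind (i.e., the boundary at infinity of the universal cover F of a compact hyperbolic surface with nonempty geodesic boundary, regarded as a convex subset of H²) has Hausdorff dimension strictly less than 1; in particular its Lebesgue measure in ∂_∞H² = S¹ is zero. -/

import Mathlib

namespace FuchsianLimit

open UpperHalfPlane Filter Topology
open scoped MatrixGroups ComplexConjugate

/-! ### Möbius action of `SL(2, ℝ)` -/

lemma det_eq_one (g : SL(2, ℝ)) : g 0 0 * g 1 1 - g 0 1 * g 1 0 = 1 := by
  have := g.det_coe
  rwa [Matrix.det_fin_two] at this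

lemma coe_smul_eq (g : SL(2, ℝ)) (w : ℍ) :
    ((g • w : ℍ) : ℂ) = (g 0 0 * w + g 0 1) / (g 1 0 * w + g 1 1) := by
  simp [coe_specialLinearGroup_apply]

lemma den_ne_zero (g : SL(2, ℝ)) (w : ℍ) : (g 1 0 * w + g 1 1 : ℂ) ≠ 0 :=
  UpperHalfPlane.denom_ne_zero (g : GL (Fin 2) ℝ) w

lemma im_smul_eq (g : SL(2, ℝ)) (w : ℍ) :
    (g • w).im = w.im / ‖(g 1 0 * w + g 1 1 : ℂ)‖ ^ 2 := by
  rw [MulAction.compHom_smul_def, im_smul_eq_div_normSq, Complex.normSq_eq_norm_sq]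
  simp [denom]

lemma norm_smul_sub_smul (g : SL(2, ℝ)) (v w : ℍ) :
    ‖((g • v : ℍ) : ℂ) - (g • w : ℍ)‖ =
      ‖(v : ℂ) - w‖ / (‖(g 1 0 * v + g 1 1 : ℂ)‖ * ‖(g 1 0 * w + g 1 1 : ℂ)‖) := by
  have hd : (g 0 0 * g 1 1 - g 0 1 * g 1 0 : ℂ) = 1 := mod_cast det_eq_one g
  rw [coe_smul_eq, coe_smul_eq, div_sub_div _ _ (den_ne_zero g v) (den_ne_zero g w),
    norm_div, norm_mul]
  congr 2
  linear_combination ((v : ℂ) - w) * hd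

/-- The matrix carrying `I` to `z` acts affinely. -/
lemma coe_toSL2R_smul (z w : ℍ) :
    ((z.toSL2R • w : ℍ) : ℂ) = z.im * w + z.re := by
  have h : (√z.im : ℂ) ≠ 0 := by simpa [Real.sqrt_ne_zero'] using z.im_pos
  have h2 : (√z.im : ℂ) * √z.im = z.im := by
    rw [← Complex.ofReal_mul, Real.mul_self_sqrt z.im_pos.le]
  rw [coe_smul_eq]
  simp only [coe_toSL2R]
  simp
  field_simp
  linear_combination (w : ℂ) * h2

lemma re_toSL2R_smul (z w : ℍ) : (z.toSL2R • w).re = z.im * w.re + z.re := by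
  have := congrArg Complex.re (coe_toSL2R_smul z w)
  simpa using this

lemma im_toSL2R_smul (z w : ℍ) : (z.toSL2R • w).im = z.im * w.im := by
  have := congrArg Complex.im (coe_toSL2R_smul z w)
  simpa using this

lemma toSL2R_inv_smul_self (z : ℍ) : z.toSL2R⁻¹ • z = I := by
  rw [inv_smul_eq_iff, toSL2R_smul_I]

/-- An element of the stabilizer of `I` is a rotation matrix. -/
lemma rotation_entries {k : SL(2, ℝ)} (hk : k • I = I) :
    k 1 1 = k 0 0 ∧ k 0 1 = - k 1 0 ∧ k 0 0 ^ 2 + k 1 0 ^ 2 = 1 := by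
  have h := coe_smul_eq k I
  rw [hk, eq_div_iff (den_ne_zero k I)] at h
  have h1 := congrArg Complex.re h
  have h2 := congrArg Complex.im h
  simp at h1 h2
  have h3 := det_eq_one k
  refine ⟨h2, by linarith, ?_⟩
  rw [h2, ← h1] at h3
  linarith

/-! ### Coarse geometry of orbits -/

/-- A set which is `R`-chain connected. -/
def ChainConnected (R : ℝ) (O : Set ℍ) : Prop :=
  ∀ U : Set ℍ, (O ∩ U).Nonempty → (∀ a ∈ O, a ∈ U → ∀ b ∈ O, dist a b ≤ R → b ∈ U) → O ⊆ U

/-- `g` maps `O` onto itself. -/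
def Preserves (g : SL(2, ℝ)) (O : Set ℍ) : Prop := ∀ w, g • w ∈ O ↔ w ∈ O

/-- The coarse properties of an orbit of a discrete finitely generated group used below. -/
structure IsNet (O : Set ℍ) : Prop where
  nonempty : O.Nonempty
  transitive : ∀ p ∈ O, ∀ q ∈ O, ∃ g : SL(2, ℝ), Preserves g O ∧ g • p = q
  finite : ∀ (p : ℍ) (r : ℝ), (O ∩ Metric.closedBall p r).Finite
  connected : ∃ R, ChainConnected R O

lemma Preserves.inv {g : SL(2, ℝ)} {O : Set ℍ} (h : Preserves g O) : Preserves g⁻¹ O := by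
  intro w
  rw [← h (g⁻¹ • w), smul_inv_smul]

lemma Preserves.mul {g h : SL(2, ℝ)} {O : Set ℍ} (hg : Preserves g O) (hh : Preserves h O) :
    Preserves (g * h) O := by
  intro w
  rw [mul_smul, hg, hh]

open scoped Pointwise in
lemma IsNet.smul {O : Set ℍ} (h : IsNet O) (g : SL(2, ℝ)) : IsNet (g • O) where
  nonempty := h.nonempty.smul_set
  transitive := by
    rintro _ ⟨p, hp, rfl⟩ _ ⟨q, hq, rfl⟩
    obtain ⟨k, hk, rfl⟩ := h.transitive p hp q hq
    refine ⟨g * k * g⁻¹, fun w ↦ ?_, by simp [mul_smul]⟩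
    rw [Set.mem_smul_set_iff_inv_smul_mem, Set.mem_smul_set_iff_inv_smul_mem]
    simp [mul_smul, hk (g⁻¹ • w)]
  finite := by
    intro p r
    refine ((h.finite (g⁻¹ • p) r).image (g • ·)).subset ?_
    rintro _ ⟨⟨q, hq, rfl⟩, hd⟩
    refine ⟨q, ⟨hq, ?_⟩, rfl⟩
    rw [Metric.mem_closedBall] at hd ⊢
    rwa [← dist_smul g, smul_inv_smul]
  connected := by
    obtain ⟨R, hR⟩ := h.connected
    refine ⟨R, fun U hne hU ↦ ?_⟩
    have := hR {w | g • w ∈ U} ?_ ?_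
    · rintro _ ⟨q, hq, rfl⟩
      exact this hq
    · obtain ⟨_, ⟨q, hq, rfl⟩, hU⟩ := hne
      exact ⟨q, hq, hU⟩
    · intro a ha haU b hb hab
      exact hU _ (Set.smul_mem_smul_set ha) haU _ (Set.smul_mem_smul_set hb)
        (by simpa using hab)

/-! ### Two nearby empty quadrants -/

/-- The numerical estimate behind `re_le_of_empty_quadrants`. -/
lemma quadrant_estimate {C X u y u' y' : ℝ} (hC : 1 ≤ C) (hX : 100 * C ^ 2 ≤ X)
    (hy0 : 0 < y) (hy : y ≤ 2) (hu : u < X / 2) (hA : (X ^ 2 + 1) * u ≤ X * (u ^ 2 + y ^ 2))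
    (hy'0 : 0 < y') (hyy' : y ≤ y' * C) (hy' : y' ≤ 2) (hd : u' ≤ u + y' * C) :
    u' < X / 2 ∧ (0 < u' → 2 * (u' ^ 2 + y' ^ 2) < y' * (X ^ 2 + 1)) := by
  have hCC : C ≤ C ^ 2 := by nlinarith
  have hX100 : 100 ≤ X := by nlinarith
  have hu1 : u ≤ y := by
    by_contra! hlt
    have hu0 : 0 < u := by linarith
    have e1 : u ^ 2 ≤ u * (X / 2) := by rw [pow_two]; gcongr
    have e2 : X * u ^ 2 ≤ X * (u * (X / 2)) := by gcongr
    have e3 : y ^ 2 ≤ 2 * u := by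
      rw [pow_two]; gcongr
    have e4 : X * y ^ 2 ≤ X * (2 * u) := by gcongr
    have e5 : 0 < X * u := by positivity
    have e6 : 100 * (X * u) ≤ X * (X * u) := by gcongr
    nlinarith
  have hu2 : u' ≤ 2 * C * y' := by linarith
  have hCy : C * y' ≤ C * 2 := by gcongr
  refine ⟨by linarith, fun hu0 ↦ ?_⟩
  have s1 : u' ^ 2 ≤ (2 * C * y') ^ 2 := by gcongr
  have s2 : y' ^ 2 ≤ 2 * y' := by rw [pow_two]; gcongr
  have s3 : (2 * C * y') ^ 2 ≤ 8 * C ^ 2 * y' := by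
    have : C ^ 2 * y' ^ 2 ≤ C ^ 2 * (2 * y') := by gcongr
    linarith
  have s4 : 16 * C ^ 2 + 4 < X ^ 2 + 1 := by nlinarith
  have s5 : y' * (16 * C ^ 2 + 4) < y' * (X ^ 2 + 1) := by gcongr
  linarith

/-- If the quadrant `{re > 0, im > 2}` and its image under a small rotation about `I`
contain no point of a chain connected set through `I`, then the set is bounded to the right. -/
lemma re_le_of_empty_quadrants {R : ℝ} (hR : 0 ≤ R) {O : Set ℍ} (hO : ChainConnected R O)
    (hI : I ∈ O) {k : SL(2, ℝ)} (hk : k • I = I) (hs : 0 < k 1 0)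
    (hX : 100 * Real.exp R ^ 2 * k 1 0 ≤ k 0 0)
    (h1 : ∀ w ∈ O, 0 < w.re → w.im ≤ 2)
    (h2 : ∀ w : ℍ, 0 < w.re → 2 < w.im → k • w ∉ O) :
    ∀ w ∈ O, w.re ≤ k 0 0 / k 1 0 := by
  obtain ⟨e1, e2, e3⟩ := rotation_entries hk
  set s := k 1 0 with hs_def
  set a := k 0 0 with ha_def
  set X := a / s with hX_def
  set C := Real.exp R with hC_def
  have hC1 : 1 ≤ C := Real.one_le_exp hR
  have hX100 : 100 * C ^ 2 ≤ X := by rw [hX_def, le_div_iff₀ hs]; linarith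
  have ha : a = X * s := by rw [hX_def]; field_simp
  -- membership in the rotated quadrant, in coordinates
  have h2' : ∀ w ∈ O, 2 * ((X - w.re) ^ 2 + w.im ^ 2) < w.im * (X ^ 2 + 1) →
      X * ((X - w.re) ^ 2 + w.im ^ 2) < (X ^ 2 + 1) * (X - w.re) → False := by
    intro w hw hi hr
    have hw' : k • (k⁻¹ • w) ∈ O := by rwa [smul_inv_smul]
    have hc := coe_smul_eq k⁻¹ w
    have i00 : k⁻¹ 0 0 = a := by simp [Matrix.SpecialLinearGroup.coe_inv, Matrix.adjugate_fin_two, e1]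
    have i01 : k⁻¹ 0 1 = s := by simp [Matrix.SpecialLinearGroup.coe_inv, Matrix.adjugate_fin_two, e2]
    have i10 : k⁻¹ 1 0 = -s := by simp [Matrix.SpecialLinearGroup.coe_inv, Matrix.adjugate_fin_two, hs_def]
    have i11 : k⁻¹ 1 1 = a := by simp [Matrix.SpecialLinearGroup.coe_inv, Matrix.adjugate_fin_two, ha_def]
    rw [i00, i01, i10, i11, ha] at hc
    have hw0 := w.im_pos
    have hN : Complex.normSq (((-s : ℝ) : ℂ) * w + ((X * s : ℝ) : ℂ)) =
        s ^ 2 * ((X - w.re) ^ 2 + w.im ^ 2) := by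
      simp [Complex.normSq_apply]; ring
    have hpos : 0 < (X - w.re) ^ 2 + w.im ^ 2 := by positivity
    have hre := congrArg Complex.re hc
    have him := congrArg Complex.im hc
    rw [Complex.div_re, hN] at hre
    rw [Complex.div_im, hN] at him
    simp at hre him
    refine h2 _ ?_ ?_ hw'
    · rw [hre, ← add_div]
      apply div_pos _ (by positivity)
      have : (X * s * w.re + s) * (-(s * w.re) + X * s) + -(X * s * w.im * (s * w.im)) =
        s ^ 2 * ((X ^ 2 + 1) * (X - w.re) - X * ((X - w.re) ^ 2 + w.im ^ 2)) := by ring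
      rw [this]
      have : 0 < (X ^ 2 + 1) * (X - w.re) - X * ((X - w.re) ^ 2 + w.im ^ 2) := by linarith
      positivity
    · rw [him, ← sub_div, lt_div_iff₀ (by positivity)]
      have : X * s * w.im * (-(s * w.re) + X * s) - -((X * s * w.re + s) * (s * w.im)) =
        s ^ 2 * (w.im * (X ^ 2 + 1)) := by ring
      rw [this]
      have : 0 < s ^ 2 := by positivity
      nlinarith
  set A : Set ℍ := {w | w.im ≤ 2 ∧ X / 2 < w.re ∧
    (X ^ 2 + 1) * (X - w.re) ≤ X * ((X - w.re) ^ 2 + w.im ^ 2)} with hA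
  have hXpos : 0 < X := by nlinarith
  have hempty : ¬ (O ∩ A).Nonempty := by
    intro hne
    have := hO A hne ?_ hI
    · have h3 := this.2.1
      simp at h3
      linarith
    · rintro v hv ⟨hv1, hv2, hv3⟩ w hw hvw
      have hv0 := v.im_pos
      have hw0 := w.im_pos
      have hexp : Real.exp (dist v w) ≤ C := Real.exp_le_exp.2 hvw
      have hwv : w.im ≤ v.im * C := (im_le_im_mul_exp_dist w v).trans
        (by rw [dist_comm]; gcongr)
      have hvw' : v.im ≤ w.im * C := (im_le_im_mul_exp_dist v w).trans (by gcongr)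
      have hd : |v.re - w.re| ≤ w.im * C := by
        have := dist_coe_le v w
        rw [Complex.dist_eq] at this
        have h3 := (Complex.abs_re_le_norm ((v : ℂ) - w)).trans this
        simp at h3
        refine h3.trans ?_
        gcongr
        linarith
      obtain ⟨hd1, hd2⟩ := abs_le.1 hd
      have hCC : C ≤ C ^ 2 := by nlinarith
      have hwC : w.im * C ≤ 2 * C ^ 2 := by
        have : w.im * C ≤ v.im * C * C := by gcongr
        have : v.im * C * C ≤ 2 * C * C := by gcongr
        linarith
      have hw2 : w.im ≤ 2 := h1 w hw (by linarith)
      obtain ⟨q1, q2⟩ := quadrant_estimate (u' := X - w.re) hC1 hX100 hv0 hv1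
        (by linarith) hv3 hw0 hvw' hw2 (by linarith)
      refine ⟨hw2, by linarith, ?_⟩
      by_contra! hlt
      refine h2' w hw (q2 ?_) hlt
      by_contra! h0
      have : (X ^ 2 + 1) * (X - w.re) ≤ 0 := mul_nonpos_of_nonneg_of_nonpos (by positivity) h0
      have : 0 < X * ((X - w.re) ^ 2 + w.im ^ 2) := by positivity
      linarith
  intro w hw
  by_contra! hlt
  refine hempty ⟨w, hw, h1 w hw (by linarith), by linarith, ?_⟩
  have : (X ^ 2 + 1) * (X - w.re) ≤ 0 :=
    mul_nonpos_of_nonneg_of_nonpos (by positivity) (by linarith)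
  have : 0 ≤ X * ((X - w.re) ^ 2 + w.im ^ 2) := by positivity
  linarith

/-! ### Parabolic elements from empty horoballs -/

/-- `q` is, up to a factor `2`, the highest point of `O` to its right. -/
def IsRecord (O : Set ℍ) (q : ℍ) : Prop := q ∈ O ∧ ∀ o ∈ O, q.re < o.re → o.im ≤ 2 * q.im

lemma exists_isRecord {O : Set ℍ} (him : ∀ o ∈ O, o.im ≤ 1) {M : ℝ} (hM : ∃ o ∈ O, M < o.re) :
    ∃ q, IsRecord O q ∧ M < q.re := by
  obtain ⟨o, ho, hoM⟩ := hM
  set T : Set ℝ := UpperHalfPlane.im '' {w ∈ O | M < w.re} with hT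
  have hne : T.Nonempty := ⟨_, o, ⟨ho, hoM⟩, rfl⟩
  have hbdd : BddAbove T := ⟨1, by rintro _ ⟨w, hw, rfl⟩; exact him w hw.1⟩
  have hpos : 0 < sSup T := o.im_pos.trans_le (le_csSup hbdd ⟨o, ⟨ho, hoM⟩, rfl⟩)
  obtain ⟨_, ⟨q, hq, rfl⟩, hlt⟩ := exists_lt_of_lt_csSup hne (half_lt_self hpos)
  refine ⟨q, ⟨hq.1, fun w hw hqw ↦ ?_⟩, hq.2⟩
  have := le_csSup hbdd ⟨w, ⟨hw, hq.2.trans hqw⟩, rfl⟩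
  linarith

lemma ChainConnected.preimage {R : ℝ} {O : Set ℍ} (h : ChainConnected R O) (g : SL(2, ℝ)) :
    ChainConnected R {w | g • w ∈ O} := by
  rintro U ⟨a, haO, haU⟩ hU b hb
  have := h {w | g⁻¹ • w ∈ U} ⟨g • a, haO, by simpa using haU⟩ ?_ hb
  · simpa using this
  · intro v hv hvU w hw hvw
    exact hU _ (by simpa using hv) hvU _ (by simpa using hw) (by simpa using hvw)

lemma rotation_inv_entries {k : SL(2, ℝ)} (hk : k • I = I) :
    k⁻¹ 0 0 = k 0 0 ∧ k⁻¹ 1 0 = - k 1 0 := by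
  obtain ⟨e1, -, -⟩ := rotation_entries hk
  simp [Matrix.SpecialLinearGroup.coe_inv, Matrix.adjugate_fin_two, e1]

/-- Two records whose frames differ by a small rotation have frames differing by an affine map. -/
lemma rotation_entry_nonpos {R : ℝ} (hR0 : 0 ≤ R) {O : Set ℍ} (hR : ChainConnected R O)
    (hub : ∀ M : ℝ, ∃ o ∈ O, M < o.re) {q q' : ℍ} (hq : IsRecord O q) (hq' : IsRecord O q')
    {r : SL(2, ℝ)} (hr : r • I = I)
    (hrO : ∀ w, q.toSL2R • (r • w) ∈ O ↔ q'.toSL2R • w ∈ O)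
    (hsmall : 100 * Real.exp R ^ 2 * r 1 0 ≤ r 0 0) : r 1 0 ≤ 0 := by
  by_contra! hpos
  have key : ∀ p : ℍ, IsRecord O p → ∀ w : ℍ, p.toSL2R • w ∈ O → 0 < w.re → w.im ≤ 2 := by
    intro p hp w hw hre
    have := hp.2 _ hw
    rw [re_toSL2R_smul, im_toSL2R_smul] at this
    have hp0 := p.im_pos
    have := this (by have : 0 < p.im * w.re := by positivity
                     linarith)
    rw [mul_comm 2] at this
    exact le_of_mul_le_mul_left this hp0
  have := re_le_of_empty_quadrants hR0 (hR.preimage q.toSL2R)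
    (by simpa [toSL2R_smul_I] using hq.1) hr hpos hsmall (key q hq)
    (fun w h1 h2 h3 ↦ absurd (key q' hq' w ((hrO w).1 h3) h1) (by linarith))
  obtain ⟨o, ho, hlt⟩ := hub (q.im * (r 0 0 / r 1 0) + q.re)
  have h3 := this (q.toSL2R⁻¹ • o) (by simpa using ho)
  have h4 := re_toSL2R_smul q (q.toSL2R⁻¹ • o)
  rw [smul_inv_smul] at h4
  have h5 : q.im * (q.toSL2R⁻¹ • o).re ≤ q.im * (r 0 0 / r 1 0) := by
    have := q.im_pos
    gcongr
  linarith

lemma translation_of_affine {O : Set ℍ} (hI : I ∈ O) (him : ∀ o ∈ O, o.im ≤ 1) {q q' : ℍ}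
    (h : Preserves (q.toSL2R * q'.toSL2R⁻¹) O) (w : ℍ) : (q.re - q'.re) +ᵥ w ∈ O ↔ w ∈ O := by
  have hq := q.im_pos
  have hq' := q'.im_pos
  have him' : ∀ w : ℍ, (q'.toSL2R⁻¹ • w).im = w.im / q'.im := by
    intro w
    have := im_toSL2R_smul q' (q'.toSL2R⁻¹ • w)
    rw [smul_inv_smul] at this
    rw [this]; field_simp
  have him2 : ∀ w : ℍ, (q.toSL2R⁻¹ • w).im = w.im / q.im := by
    intro w
    have := im_toSL2R_smul q (q.toSL2R⁻¹ • w)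
    rw [smul_inv_smul] at this
    rw [this]; field_simp
  have l1 := him _ ((h I).2 hI)
  have l2 := him _ ((h.inv I).2 hI)
  rw [mul_smul, im_toSL2R_smul, him', I_im] at l1
  rw [mul_inv_rev, inv_inv, mul_smul, im_toSL2R_smul, him2, I_im] at l2
  rw [mul_one_div, div_le_one₀ (by positivity)] at l1 l2
  have heq : q.im = q'.im := le_antisymm l1 l2
  rw [← h w]
  congr! 1
  have h1 := coe_toSL2R_smul q' (q'.toSL2R⁻¹ • w)
  rw [smul_inv_smul] at h1
  apply UpperHalfPlane.ext
  rw [mul_smul, coe_toSL2R_smul, coe_vadd, h1, heq]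
  push_cast
  ring

lemma isCompact_stabilizer_I : IsCompact {k : SL(2, ℝ) | k • I = I} := by
  have := isProperMap_smul_I.isCompact_preimage (isCompact_singleton (x := I))
  exact this

lemma continuous_entry (i j : Fin 2) : Continuous fun g : SL(2, ℝ) ↦ g i j :=
  (continuous_subtype_val (p := fun A : Matrix (Fin 2) (Fin 2) ℝ ↦ A.det = 1)).matrix_elem i j

instance : FirstCountableTopology SL(2, ℝ) :=
  have : FirstCountableTopology (Matrix (Fin 2) (Fin 2) ℝ) :=
    inferInstanceAs (FirstCountableTopology (Fin 2 → Fin 2 → ℝ))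
  TopologicalSpace.Subtype.firstCountableTopology _

/-- A net which lies below its point `I` and is unbounded to the right is periodic. -/
lemma exists_translation_of_unbounded_right {O : Set ℍ} (h : IsNet O) (hI : I ∈ O)
    (him : ∀ o ∈ O, o.im ≤ 1) (hub : ∀ M : ℝ, ∃ o ∈ O, M < o.re) :
    ∃ l : ℝ, l ≠ 0 ∧ ∀ w : ℍ, l +ᵥ w ∈ O ↔ w ∈ O := by
  obtain ⟨R, hR⟩ := h.connected
  have hR' : ChainConnected (max R 0) O := fun U hne hU ↦
    hR U hne fun a ha haU b hb hab ↦ hU a ha haU b hb (hab.trans (le_max_left _ _))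
  have hR0 : 0 ≤ max R 0 := le_max_right _ _
  generalize max R 0 = R at hR' hR0
  choose q hq hqn using fun n : ℕ ↦ exists_isRecord him (hub n)
  choose γ hγ hγq using fun n ↦ h.transitive (q n) (hq n).1 I hI
  set ρ : ℕ → SL(2, ℝ) := fun n ↦ γ n * (q n).toSL2R with hρ
  have hρI : ∀ n, ρ n • I = I := fun n ↦ by
    simp only [hρ, mul_smul, toSL2R_smul_I, hγq]
  obtain ⟨k, -, φ, hφ, hk⟩ := isCompact_stabilizer_I.tendsto_subseq (x := ρ) hρI
  have hlim : Tendsto (fun p : ℕ × ℕ ↦ (ρ (φ p.1))⁻¹ * ρ (φ p.2)) (atTop ×ˢ atTop) (𝓝 1) := by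
    have := (hk.comp (tendsto_fst (f := atTop) (g := atTop))).inv.mul
      (hk.comp (tendsto_snd (f := atTop) (g := atTop)))
    simpa using this
  have hopen : ∀ᶠ r : SL(2, ℝ) in 𝓝 1, 100 * Real.exp R ^ 2 * |r 1 0| < r 0 0 := by
    apply (IsOpen.mem_nhds (isOpen_lt _ (continuous_entry 0 0)))
    · simp
    · exact continuous_const.mul (continuous_entry 1 0).abs
  obtain ⟨P, hP, Q, hQ, hPQ⟩ := eventually_prod_iff.1 (hlim.eventually hopen)
  obtain ⟨m, hm⟩ := hP.exists
  obtain ⟨n, hn, hnm⟩ := (hQ.and ((tendsto_natCast_atTop_atTop (R := ℝ)).eventually_ge_atTop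
    (q (φ m)).re)).exists
  have hsmall := hPQ hm hn
  have hre : (q (φ m)).re < (q (φ n)).re := by
    have : (n : ℝ) ≤ φ n := mod_cast hφ.id_le n
    linarith [hqn (φ n)]
  generalize φ m = i at *
  generalize φ n = j at *
  have hr : ((ρ i)⁻¹ * ρ j) • I = I := by
    rw [mul_smul, hρI, inv_smul_eq_iff, hρI]
  have hrO : ∀ i j : ℕ, ∀ w, (q i).toSL2R • (((ρ i)⁻¹ * ρ j) • w) ∈ O ↔ (q j).toSL2R • w ∈ O := by
    intro i j w
    rw [← hγ i, ← mul_smul (γ i), ← mul_smul, mul_inv_cancel_left, mul_smul, hγ j]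
  have s1 : ((ρ i)⁻¹ * ρ j) 1 0 ≤ 0 := by
    refine rotation_entry_nonpos hR0 hR' hub (hq i) (hq j) hr (hrO i j) ?_
    refine le_trans ?_ hsmall.le
    gcongr
    exact le_abs_self _
  have s2 : ((ρ j)⁻¹ * ρ i) 1 0 ≤ 0 := by
    have hinv : (ρ j)⁻¹ * ρ i = ((ρ i)⁻¹ * ρ j)⁻¹ := by simp
    obtain ⟨e1, e2⟩ := rotation_inv_entries hr
    rw [← hinv] at e1 e2
    refine rotation_entry_nonpos hR0 hR' hub (hq j) (hq i) ?_ (hrO j i) ?_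
    · rw [hinv, inv_smul_eq_iff, hr]
    · rw [e1, e2]
      refine le_trans ?_ hsmall.le
      gcongr
      exact neg_le_abs _
  have hone : (ρ i)⁻¹ * ρ j = 1 := by
    have hinv : (ρ j)⁻¹ * ρ i = ((ρ i)⁻¹ * ρ j)⁻¹ := by simp
    obtain ⟨e1, e2⟩ := rotation_inv_entries hr
    rw [← hinv] at e1 e2
    obtain ⟨f1, f2, f3⟩ := rotation_entries hr
    have h0 : ((ρ i)⁻¹ * ρ j) 1 0 = 0 := le_antisymm s1 (by linarith)
    rw [h0] at hsmall f2 f3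
    simp only [abs_zero, mul_zero] at hsmall
    have h1 : ((ρ i)⁻¹ * ρ j) 0 0 = 1 := by nlinarith
    ext a b
    fin_cases a <;> fin_cases b
    · simpa using h1
    · simpa using f2
    · simpa using h0
    · simpa [h1] using f1
  rw [inv_mul_eq_one] at hone
  refine ⟨(q i).re - (q j).re, by linarith, translation_of_affine hI him ?_⟩
  have : (q i).toSL2R * (q j).toSL2R⁻¹ = (γ i)⁻¹ * γ j := by
    rw [eq_inv_mul_iff_mul_eq, ← mul_assoc, mul_inv_eq_iff_eq_mul]
    exact hone
  rw [this]
  exact (hγ i).inv.mul (hγ j)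

/-! ### The reflection in the imaginary axis -/

/-- The reflection `w ↦ -conj w`. -/
noncomputable def mirror (w : ℍ) : ℍ := ⟨-conj (w : ℂ), by simpa using w.im_pos⟩

lemma coe_mirror (w : ℍ) : (mirror w : ℂ) = -conj (w : ℂ) := rfl

@[simp] lemma mirror_re (w : ℍ) : (mirror w).re = - w.re := by
  change (mirror w : ℂ).re = _
  simp [coe_mirror]

@[simp] lemma mirror_im (w : ℍ) : (mirror w).im = w.im := by
  change (mirror w : ℂ).im = _
  simp [coe_mirror]

@[simp] lemma mirror_mirror (w : ℍ) : mirror (mirror w) = w := by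
  apply UpperHalfPlane.ext
  simp [coe_mirror]

@[simp] lemma mirror_I : mirror I = I := by
  apply UpperHalfPlane.ext
  simp [coe_mirror]

lemma dist_mirror (v w : ℍ) : dist (mirror v) (mirror w) = dist v w := by
  have h : dist (mirror v : ℂ) (mirror w) = dist (v : ℂ) w := by
    rw [coe_mirror, coe_mirror, dist_neg_neg, Complex.dist_conj_conj]
  rw [dist_eq, dist_eq, h, mirror_im, mirror_im]

/-- Conjugation of a matrix by the reflection. -/
def mirrorConj (g : SL(2, ℝ)) : SL(2, ℝ) :=
  ⟨!![g 0 0, - g 0 1; - g 1 0, g 1 1], by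
    rw [Matrix.det_fin_two_of]; linarith [det_eq_one g]⟩

lemma mirror_smul (g : SL(2, ℝ)) (w : ℍ) : mirror (g • w) = mirrorConj g • mirror w := by
  apply UpperHalfPlane.ext
  rw [coe_mirror, coe_smul_eq, coe_smul_eq, coe_mirror]
  simp only [mirrorConj, map_div₀, map_add, map_mul, Complex.conj_ofReal]
  simp only [Matrix.of_apply, Matrix.cons_val', Matrix.cons_val_zero, Matrix.cons_val_one,
    Matrix.cons_val_fin_one, Complex.ofReal_neg]
  rw [← neg_div]
  congr 1 <;> ring

lemma IsNet.mirror {O : Set ℍ} (h : IsNet O) : IsNet {w | mirror w ∈ O} where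
  nonempty := by
    obtain ⟨o, ho⟩ := h.nonempty
    exact ⟨FuchsianLimit.mirror o, by simpa using ho⟩
  transitive := by
    intro p hp q hq
    obtain ⟨g, hg, hgp⟩ := h.transitive _ hp _ hq
    refine ⟨mirrorConj g, fun w ↦ ?_, ?_⟩
    · rw [Set.mem_ofPred_eq, Set.mem_ofPred_eq, ← hg (FuchsianLimit.mirror w)]
      nth_rw 1 [← mirror_mirror w]
      rw [← mirror_smul, mirror_mirror]
    · rw [← mirror_mirror p, ← mirror_smul, hgp, mirror_mirror]
  finite := by
    intro p r
    refine ((h.finite (FuchsianLimit.mirror p) r).image FuchsianLimit.mirror).subset ?_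
    rintro w ⟨hw, hd⟩
    exact ⟨FuchsianLimit.mirror w, ⟨hw, by simpa [dist_mirror] using hd⟩, by simp⟩
  connected := by
    obtain ⟨R, hR⟩ := h.connected
    refine ⟨R, ?_⟩
    rintro U ⟨a, haO, haU⟩ hU b hb
    have := hR {w | FuchsianLimit.mirror w ∈ U} ⟨_, haO, by simpa using haU⟩ ?_ hb
    · simpa using this
    · intro v hv hvU w hw hvw
      exact hU _ (by simpa using hv) hvU _ (by simpa using hw) (by simpa [dist_mirror] using hvw)

lemma exists_translation {O : Set ℍ} (h : IsNet O) (hI : I ∈ O)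
    (him : ∀ o ∈ O, o.im ≤ 1) (hub : ∀ M : ℝ, ∃ o ∈ O, M < |o.re|) :
    ∃ l : ℝ, l ≠ 0 ∧ ∀ w : ℍ, l +ᵥ w ∈ O ↔ w ∈ O := by
  by_cases hr : ∀ M : ℝ, ∃ o ∈ O, M < o.re
  · exact exists_translation_of_unbounded_right h hI him hr
  push Not at hr
  obtain ⟨M, hM⟩ := hr
  obtain ⟨l, hl, hlO⟩ := exists_translation_of_unbounded_right h.mirror (by simpa using hI)
    (fun o ho ↦ by simpa using him _ ho) (fun N ↦ by
      obtain ⟨o, ho, hlt⟩ := hub (max M N)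
      refine ⟨mirror o, by simpa using ho, ?_⟩
      rw [mirror_re]
      rcases lt_abs.1 hlt with h1 | h1
      · linarith [hM o ho, le_max_left M N]
      · linarith [le_max_right M N])
  refine ⟨-l, neg_ne_zero.2 hl, fun w ↦ ?_⟩
  have := hlO (mirror w)
  simp only [Set.mem_ofPred_eq, mirror_mirror] at this
  rw [← this]
  congr! 1
  apply UpperHalfPlane.ext
  simp [coe_mirror, coe_vadd, add_comm]

/-! ### Rotations about `I` -/

lemma exists_rotation (a s : ℝ) (h : a ^ 2 + s ^ 2 = 1) :
    ∃ k : SL(2, ℝ), k • I = I ∧ k 1 0 = s ∧ k 1 1 = a := by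
  obtain ⟨k, h00, h01, h10, h11⟩ : ∃ k : SL(2, ℝ), k 0 0 = a ∧ k 0 1 = -s ∧ k 1 0 = s ∧ k 1 1 = a :=
    ⟨⟨!![a, -s; s, a], by rw [Matrix.det_fin_two_of]; linarith⟩, rfl, rfl, rfl, rfl⟩
  refine ⟨k, ?_, h10, h11⟩
  apply UpperHalfPlane.ext
  rw [coe_smul_eq, div_eq_iff (den_ne_zero _ _), h00, h01, h10, h11]
  apply Complex.ext <;> simp

/-- Every point can be rotated about `I` onto the imaginary ray above `I`. -/
lemma exists_rotation_smul_re_eq_zero (p : ℍ) :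
    ∃ k : SL(2, ℝ), k • I = I ∧ (k • p).re = 0 ∧ 1 ≤ (k • p).im := by
  have hcont : Continuous fun k : SL(2, ℝ) ↦ (k • p).im :=
    UpperHalfPlane.continuous_im.comp (continuous_id.smul continuous_const)
  obtain ⟨k, hk, hmax⟩ := isCompact_stabilizer_I.exists_isMaxOn ⟨1, one_smul _ _⟩
    hcont.continuousOn
  refine ⟨k, hk, ?_⟩
  have hk' : k • I = I := hk
  set P := k • p with hP
  have hPim := P.im_pos
  have key : ∀ a s : ℝ, 0 ≤ s ^ 2 * (P.re ^ 2 + P.im ^ 2 - 1) + 2 * a * s * P.re := by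
    intro a s
    by_cases h0 : a ^ 2 + s ^ 2 = 0
    · have : s = 0 := by nlinarith
      simp [this]
    have hpos : 0 < a ^ 2 + s ^ 2 := lt_of_le_of_ne (by positivity) (Ne.symm h0)
    set N := √(a ^ 2 + s ^ 2) with hN
    have hN2 : N ^ 2 = a ^ 2 + s ^ 2 := Real.sq_sqrt hpos.le
    have hNpos : 0 < N := Real.sqrt_pos.2 hpos
    obtain ⟨r, hr, r10, r11⟩ := exists_rotation (a / N) (s / N) (by field_simp; linarith)
    have := hmax (show r * k ∈ {k : SL(2, ℝ) | k • I = I} by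
      change (r * k) • I = I
      rw [mul_smul, hk', hr])
    simp only [Set.mem_ofPred_eq, mul_smul, ← hP] at this
    rw [im_smul_eq, r10, r11, div_le_iff₀ (by
      have := den_ne_zero r P
      rw [r10, r11] at this
      positivity), ← Complex.normSq_eq_norm_sq, Complex.normSq_apply] at this
    simp at this
    have h2 : 1 ≤ (s / N * P.re + a / N) * (s / N * P.re + a / N) +
        s / N * P.im * (s / N * P.im) := by
      by_contra! hlt
      nlinarith
    have h3 : (s / N * P.re + a / N) * (s / N * P.re + a / N) +
        s / N * P.im * (s / N * P.im) = ((s * P.re + a) ^ 2 + s ^ 2 * P.im ^ 2) / N ^ 2 := by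
      field_simp
    rw [h3, le_div_iff₀ (by positivity), hN2] at h2
    linarith
  have hre : P.re = 0 := by
    by_contra hne
    have := key (-(P.re ^ 2 + P.im ^ 2) / (2 * P.re)) 1
    have e : 2 * (-(P.re ^ 2 + P.im ^ 2) / (2 * P.re)) * 1 * P.re = -(P.re ^ 2 + P.im ^ 2) := by
      field_simp
    rw [e] at this
    linarith
  refine ⟨hre, ?_⟩
  have := key 0 1
  rw [hre] at this
  nlinarith

/-- A sequence leaving every compact set is, after a rotation about `I`, unbounded in `ℂ`. -/
lemma exists_rotation_unbounded (P : ℕ → ℍ) (hP : ∀ n : ℕ, n < dist (P n) I) :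
    ∃ k : SL(2, ℝ), k • I = I ∧ ∀ M : ℝ, ∃ n, M < ‖((k • P n : ℍ) : ℂ)‖ := by
  choose κ hκ hre him using fun n ↦ exists_rotation_smul_re_eq_zero (P n)
  obtain ⟨k, hk, φ, hφ, hlim⟩ := isCompact_stabilizer_I.tendsto_subseq (x := κ) hκ
  have hk' : k • I = I := hk
  refine ⟨k, hk, fun M ↦ ?_⟩
  have hlim' : Tendsto (fun n ↦ k * (κ (φ n))⁻¹) atTop (𝓝 1) := by
    simpa using (tendsto_const_nhds (x := k)).mul hlim.inv
  have hopen : ∀ᶠ r : SL(2, ℝ) in 𝓝 1, 4 * M ^ 2 * r 1 0 ^ 2 < 1 ∧ 1 < 2 * r 0 0 ^ 2 := by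
    apply Filter.Eventually.and
    · apply (IsOpen.mem_nhds (isOpen_lt (continuous_const.mul ((continuous_entry 1 0).pow 2))
        continuous_const))
      simp
    · apply (IsOpen.mem_nhds (isOpen_lt continuous_const
        (continuous_const.mul ((continuous_entry 0 0).pow 2))))
      simp
  obtain ⟨n, ⟨hn1, hn2⟩, hnM⟩ := ((hlim'.eventually hopen).and
    ((tendsto_natCast_atTop_atTop (R := ℝ)).eventually_ge_atTop (2 * |M|))).exists
  refine ⟨φ n, ?_⟩
  have hn : (n : ℝ) ≤ φ n := mod_cast hφ.id_le n
  have hPn := hP (φ n)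
  generalize φ n = m at *
  set r := k * (κ m)⁻¹ with hr
  have hrI : r • I = I := by
    rw [hr, mul_smul, inv_smul_eq_iff.2 (hκ m).symm, hk']
  obtain ⟨e1, e2, e3⟩ := rotation_entries hrI
  have hkP : k • P m = r • (κ m • P m) := by rw [hr, mul_smul, inv_smul_smul]
  set w := κ m • P m with hw
  have hdist : dist (P m) I = Real.log w.im := by
    rw [← dist_smul (κ m), hκ m, ← hw, dist_of_re_eq (by simp [w, hre m])]
    simpa using Real.log_nonneg (him m)
  have ht : 2 * |M| < w.im := by
    have h1 : Real.log w.im < w.im := by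
      have := Real.log_le_sub_one_of_pos w.im_pos
      linarith
    linarith
  have hwc : (w : ℂ) = w.im * Complex.I := by
    apply Complex.ext <;> simp [w, hre m]
  have ht2 : 4 * M ^ 2 < w.im ^ 2 := by
    have h1 : (2 * |M|) ^ 2 < w.im ^ 2 := by gcongr
    rw [mul_pow, sq_abs] at h1
    linarith
  rw [hkP, coe_smul_eq, norm_div, lt_div_iff₀ (norm_pos_iff.2 (den_ne_zero _ _)), e1, e2, hwc]
  apply lt_of_pow_lt_pow_left₀ 2 (norm_nonneg _)
  rw [mul_pow, ← Complex.normSq_eq_norm_sq, ← Complex.normSq_eq_norm_sq,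
    Complex.normSq_apply, Complex.normSq_apply]
  simp
  generalize w.im = t at *
  generalize r 1 0 = s at *
  generalize r 0 0 = a at *
  have h1 : t ^ 2 * 1 ≤ t ^ 2 * (2 * a ^ 2) := by gcongr
  have h2 : t ^ 2 * (4 * M ^ 2 * s ^ 2) ≤ t ^ 2 * 1 := by gcongr
  have h3 : M ^ 2 * (a ^ 2 + s ^ 2) = M ^ 2 := by rw [e3, mul_one]
  nlinarith [sq_nonneg (M * s), sq_nonneg s]

/-! ### Visible points and cusps -/

/-- `O` does not look like a single point from `p`: the quantity compared is invariant under
the action of `SL(2, ℝ)`. -/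
def Visible (O : Set ℍ) (p : ℍ) : Prop := ∃ o ∈ O, ∃ o' ∈ O,
  ‖(p : ℂ) - o‖ * ‖(p : ℂ) - o'‖ ≤ 10 * (p.im * ‖(o : ℂ) - o'‖)

lemma visible_ineq_smul (g : SL(2, ℝ)) {p o o' : ℍ}
    (h : ‖(p : ℂ) - o‖ * ‖(p : ℂ) - o'‖ ≤ 10 * (p.im * ‖(o : ℂ) - o'‖)) :
    ‖((g • p : ℍ) : ℂ) - (g • o : ℍ)‖ * ‖((g • p : ℍ) : ℂ) - (g • o' : ℍ)‖ ≤
      10 * ((g • p).im * ‖((g • o : ℍ) : ℂ) - (g • o' : ℍ)‖) := by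
  rw [norm_smul_sub_smul, norm_smul_sub_smul, norm_smul_sub_smul, im_smul_eq]
  have h1 := norm_pos_iff.2 (den_ne_zero g p)
  have h2 := norm_pos_iff.2 (den_ne_zero g o)
  have h3 := norm_pos_iff.2 (den_ne_zero g o')
  generalize ‖(g 1 0 * p + g 1 1 : ℂ)‖ = a at *
  generalize ‖(g 1 0 * o + g 1 1 : ℂ)‖ = b at *
  generalize ‖(g 1 0 * o' + g 1 1 : ℂ)‖ = c at *
  have e1 : ‖(p : ℂ) - o‖ / (a * b) * (‖(p : ℂ) - o'‖ / (a * c)) =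
    ‖(p : ℂ) - o‖ * ‖(p : ℂ) - o'‖ / (a ^ 2 * b * c) := by field_simp
  have e2 : 10 * (p.im / a ^ 2 * (‖(o : ℂ) - o'‖ / (b * c))) =
    10 * (p.im * ‖(o : ℂ) - o'‖) / (a ^ 2 * b * c) := by field_simp
  rw [e1, e2]
  gcongr

lemma sq_mul_im_le_of_dist_le {p o : ℍ} (h : dist p I ≤ dist p o) :
    ‖(p : ℂ) - Complex.I‖ ^ 2 * o.im ≤ ‖(p : ℂ) - o‖ ^ 2 := by
  have h1 : Real.cosh (dist p I) ≤ Real.cosh (dist p o) := by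
    rw [Real.cosh_le_cosh, abs_of_nonneg dist_nonneg, abs_of_nonneg dist_nonneg]
    exact h
  rw [cosh_dist, cosh_dist, add_le_add_iff_left, Complex.dist_eq, Complex.dist_eq,
    div_le_div_iff₀ (by have := p.im_pos; have := I.im_pos; positivity)
    (by have := p.im_pos; have := o.im_pos; positivity)] at h1
  have hp : 0 < 2 * p.im := by have := p.im_pos; positivity
  simp only [coe_I, I_im] at h1
  refine le_of_mul_le_mul_left ?_ hp
  linarith

/-- A frame `g` sending a cusp to infinity, normalized so that the maximal horoball free of `O`
is `{im > 1}`; the parabolic group contains the translation by `l`. -/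
structure CuspFrame (O : Set ℍ) (g : SL(2, ℝ)) (l : ℝ) : Prop where
  le_one : ∀ o ∈ O, (g • o).im ≤ 1
  attained : ∃ o ∈ O, (g • o).im = 1
  ne_zero : l ≠ 0
  periodic : ∀ w, g⁻¹ • (l +ᵥ g • w) ∈ O ↔ w ∈ O

lemma CuspFrame.mul {O : Set ℍ} {g γ : SL(2, ℝ)} {l : ℝ} (h : CuspFrame O g l)
    (hγ : Preserves γ O) : CuspFrame O (g * γ) l where
  le_one o ho := by
    rw [mul_smul]
    exact h.le_one _ ((hγ o).2 ho)
  attained := by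
    obtain ⟨o, ho, ho1⟩ := h.attained
    exact ⟨γ⁻¹ • o, (hγ.inv o).2 ho, by simpa [mul_smul] using ho1⟩
  ne_zero := h.ne_zero
  periodic w := by
    rw [mul_smul, mul_inv_rev, mul_smul, hγ.inv, h.periodic, hγ]

lemma CuspFrame.int_periodic {O : Set ℍ} {g : SL(2, ℝ)} {l : ℝ} (h : CuspFrame O g l)
    {w : ℍ} (hw : w ∈ O) (j : ℤ) : g⁻¹ • ((j * l) +ᵥ g • w) ∈ O := by
  induction j using Int.induction_on with
  | zero => simpa using hw
  | succ n ih =>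
    have := (h.periodic _).2 ih
    rw [smul_inv_smul, vadd_vadd] at this
    convert this using 3
    push_cast; ring
  | pred n ih =>
    rw [← h.periodic, smul_inv_smul, vadd_vadd]
    convert ih using 3
    push_cast; ring

/-- Deep points of a horoball determine the cusp. -/
lemma CuspFrame.im_eq {O : Set ℍ} {g g' : SL(2, ℝ)} {l l' : ℝ} (h : CuspFrame O g l)
    (h' : CuspFrame O g' l') {p : ℍ} (hp : 1 + l ^ 2 < (g • p).im) (hp' : 1 < (g' • p).im)
    (w : ℍ) : (g • w).im = (g' • w).im := by
  obtain ⟨k, rfl⟩ : ∃ k, g' = k * g := ⟨g' * g⁻¹, by group⟩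
  rw [mul_smul] at hp' ⊢
  obtain ⟨q, hq, hq1⟩ := h.attained
  have key : ∀ v : ℍ, ‖(k 1 0 * v + k 1 1 : ℂ)‖ ^ 2 =
      (k 1 0 * v.re + k 1 1) ^ 2 + (k 1 0 * v.im) ^ 2 := by
    intro v
    rw [← Complex.normSq_eq_norm_sq, Complex.normSq_apply]
    simp
    ring
  by_cases hc : k 1 0 = 0
  · have hk : ∀ v : ℍ, (k • v).im = v.im / (k 1 1) ^ 2 := by
      intro v
      rw [im_smul_eq, key, hc]
      simp
    have hd : k 1 1 ≠ 0 := by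
      intro h0
      have := det_eq_one k
      rw [hc, h0] at this
      simp at this
    have hd2 : 0 < k 1 1 ^ 2 := by positivity
    have i1 := h'.le_one q hq
    rw [mul_smul, hk, hq1, div_le_one₀ hd2] at i1
    obtain ⟨q', hq', hq1'⟩ := h'.attained
    rw [mul_smul, hk, div_eq_one_iff_eq hd2.ne'] at hq1'
    have i2 := h.le_one q' hq'
    rw [hk, le_antisymm (hq1' ▸ i2) i1, div_one]
  · exfalso
    rw [im_smul_eq, key, one_lt_div (by rw [← key]; have := den_ne_zero k (g • p); positivity)]
      at hp'
    have hc2 : 0 < k 1 0 ^ 2 := by positivity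
    have c1 : k 1 0 ^ 2 * (1 + l ^ 2) < 1 := by
      have h1 : k 1 0 ^ 2 * (g • p).im < 1 := by
        have h0 := (g • p).im_pos
        by_contra! hge
        nlinarith [sq_nonneg (k 1 0 * (g • p).re + k 1 1)]
      nlinarith
    set x := ((g • q).re + k 1 1 / k 1 0) / l with hx
    have hl := h.ne_zero
    have hj := abs_sub_round x
    set v : ℍ := ((-round x : ℤ) * l) +ᵥ g • q with hv
    have hvO := h'.le_one _ (h.int_periodic hq (-round x))
    rw [← hv, mul_smul, smul_inv_smul, im_smul_eq, key, div_le_one₀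
      (by rw [← key]; have := den_ne_zero k v; positivity)] at hvO
    have hvim : v.im = 1 := by rw [hv, vadd_im, hq1]
    have hvre : k 1 0 * v.re + k 1 1 = k 1 0 * l * (x - round x) := by
      rw [hv, vadd_re, hx]
      push_cast
      field_simp
      ring
    have hj2 : (x - round x) ^ 2 ≤ 1 := by
      rw [← sq_abs]
      have : |x - round x| ≤ 1 := hj.trans (by norm_num)
      nlinarith [abs_nonneg (x - round x)]
    rw [hvim, hvre, mul_pow] at hvO
    nlinarith [mul_nonneg (sq_nonneg (k 1 0 * l)) (sub_nonneg.2 hj2)]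

lemma IsNet.exists_nearest {O : Set ℍ} (h : IsNet O) (p : ℍ) :
    ∃ o ∈ O, ∀ o' ∈ O, dist p o ≤ dist p o' := by
  obtain ⟨b, hb⟩ := h.nonempty
  obtain ⟨o, ho, hmin⟩ := (h.finite p (dist p b)).exists_minimalFor (dist p) _
    ⟨b, hb, by simp [dist_comm]⟩
  refine ⟨o, ho.1, fun o' ho' ↦ ?_⟩
  rcases le_total (dist p o') (dist p o) with h1 | h1
  · refine hmin ⟨ho', ?_⟩ h1
    rw [Metric.mem_closedBall, dist_comm]
    have := ho.2
    rw [Metric.mem_closedBall, dist_comm] at this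
    exact h1.trans this
  · exact h1

/-- A net seen from a sequence of visible points going to infinity, all of which have `I` as
nearest point, is periodic. -/
lemma exists_translation_of_visible {O : Set ℍ} (h : IsNet O) (hI : I ∈ O) {Q : ℕ → ℍ}
    (hQ : ∀ M : ℝ, ∃ n, M < ‖(Q n : ℂ)‖) (hvis : ∀ n, Visible O (Q n))
    (hnear : ∀ n, ∀ o ∈ O, dist (Q n) I ≤ dist (Q n) o) :
    ∃ l : ℝ, l ≠ 0 ∧ (∀ o ∈ O, o.im ≤ 1) ∧ (∀ w : ℍ, l +ᵥ w ∈ O ↔ w ∈ O) ∧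
      ∀ n, |(Q n).re| ≤ |l| := by
  have him : ∀ o ∈ O, o.im ≤ 1 := by
    intro o ho
    by_contra! hgt
    obtain ⟨e, he, he1⟩ : ∃ e : ℝ, 0 < e ∧ (1 + e) ^ 2 ≤ o.im := by
      have h1 : 1 < √o.im := by rwa [Real.lt_sqrt zero_le_one, one_pow]
      refine ⟨√o.im - 1, by linarith, ?_⟩
      rw [add_sub_cancel, Real.sq_sqrt o.im_pos.le]
    obtain ⟨n, hn⟩ := hQ (1 + (1 + ‖(o : ℂ)‖) / e)
    have h1 := sq_mul_im_le_of_dist_le (hnear n o ho)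
    set q := ‖(Q n : ℂ)‖ with hq
    have h2 : q - 1 ≤ ‖(Q n : ℂ) - Complex.I‖ := by
      have := norm_sub_norm_le (Q n : ℂ) Complex.I
      simpa using this
    have h3 : ‖(Q n : ℂ) - o‖ ≤ q + ‖(o : ℂ)‖ := norm_sub_le _ _
    have h4 : (1 + ‖(o : ℂ)‖) / e < q - 1 := by linarith
    rw [div_lt_iff₀ he] at h4
    have h5 : 0 < q - 1 := by
      have : 0 ≤ (1 + ‖(o : ℂ)‖) / e := by positivity
      linarith
    have h6 : ((q - 1) * (1 + e)) ^ 2 ≤ (q + ‖(o : ℂ)‖) ^ 2 := by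
      calc ((q - 1) * (1 + e)) ^ 2 = (q - 1) ^ 2 * (1 + e) ^ 2 := by ring
        _ ≤ ‖(Q n : ℂ) - Complex.I‖ ^ 2 * o.im := by gcongr
        _ ≤ ‖(Q n : ℂ) - o‖ ^ 2 := h1
        _ ≤ _ := by gcongr
    have h7 := (sq_le_sq₀ (by positivity) (by positivity)).1 h6
    nlinarith
  have hub : ∀ M : ℝ, ∃ o ∈ O, M < |o.re| := by
    by_contra! hcon
    obtain ⟨M, hM⟩ := hcon
    have hB : ∀ o ∈ O, ‖(o : ℂ)‖ ≤ |M| + 1 := by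
      intro o ho
      have h1 := Complex.norm_le_abs_re_add_abs_im (o : ℂ)
      simp only [coe_re, coe_im, abs_of_pos o.im_pos] at h1
      linarith [hM o ho, him o ho, le_abs_self M]
    set B := |M| + 1 with hBdef
    have hB1 : 1 ≤ B := by have := abs_nonneg M; linarith
    obtain ⟨n, hn⟩ := hQ (100 * B)
    obtain ⟨o, ho, o', ho', hoo⟩ := hvis n
    set q := ‖(Q n : ℂ)‖ with hq
    have h1 : q - B ≤ ‖(Q n : ℂ) - o‖ := by
      linarith [norm_sub_norm_le (Q n : ℂ) o, hB o ho]
    have h2 : q - B ≤ ‖(Q n : ℂ) - o'‖ := by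
      linarith [norm_sub_norm_le (Q n : ℂ) o', hB o' ho']
    have h3 : ‖(o : ℂ) - o'‖ ≤ 2 * B := by
      linarith [norm_sub_le (o : ℂ) o', hB o ho, hB o' ho']
    have h4 : (Q n).im ≤ q := by
      have := Complex.abs_im_le_norm (Q n : ℂ)
      rw [coe_im] at this
      linarith [le_abs_self (Q n).im]
    have h5 : (q - B) * (q - B) ≤ ‖(Q n : ℂ) - o‖ * ‖(Q n : ℂ) - o'‖ := by
      have : 0 ≤ q - B := by linarith
      gcongr
    have h6 : (Q n).im * ‖(o : ℂ) - o'‖ ≤ q * (2 * B) := by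
      have := (Q n).im_pos
      gcongr
    nlinarith
  obtain ⟨l, hl, hlO⟩ := exists_translation h hI him hub
  refine ⟨l, hl, him, hlO, fun n ↦ ?_⟩
  have h1 := sq_mul_im_le_of_dist_le (hnear n _ ((hlO I).2 hI))
  have h2 := sq_mul_im_le_of_dist_le (hnear n (-l +ᵥ I) (by
    rw [← hlO, vadd_vadd]; simpa using hI))
  rw [← Complex.normSq_eq_norm_sq, ← Complex.normSq_eq_norm_sq, Complex.normSq_apply,
    Complex.normSq_apply, vadd_im, coe_vadd] at h1 h2
  simp at h1 h2
  have h3 : |(Q n).re * l| ≤ |l| * |l| := by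
    rw [abs_mul_abs_self]
    exact abs_le.2 ⟨by nlinarith, by nlinarith⟩
  rw [abs_mul] at h3
  exact le_of_mul_le_mul_right h3 (abs_pos.2 hl)

open scoped Pointwise in
/-- A visible point is near the net or deep in a horoball. -/
lemma thick_or_cusp {O : Set ℍ} (h : IsNet O) (K : ℝ) : ∃ D : ℝ, ∀ p, Visible O p →
    (∃ o ∈ O, dist p o ≤ D) ∨ ∃ g l, CuspFrame O g l ∧ K * (1 + l ^ 2) < (g • p).im := by
  by_contra! hcon
  choose p hvis hfar hcusp using fun n : ℕ ↦ hcon n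
  obtain ⟨b, hb⟩ := h.nonempty
  choose o ho hmin using fun n ↦ h.exists_nearest (p n)
  choose γ hγ hγo using fun n ↦ h.transitive (o n) (ho n) b hb
  have hfI : b.toSL2R⁻¹ • b = I := toSL2R_inv_smul_self b
  obtain ⟨k, hk, hunb⟩ := exists_rotation_unbounded (fun n ↦ (b.toSL2R⁻¹ * γ n) • p n) (fun n ↦ by
    rw [← hfI, ← hγo n, ← mul_smul, dist_smul]
    exact hfar n _ (ho n))
  obtain ⟨g, hg⟩ : ∃ g, g = k * b.toSL2R⁻¹ := ⟨_, rfl⟩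
  have hQ : ∀ n, k • ((b.toSL2R⁻¹ * γ n) • p n) = (g * γ n) • p n := fun n ↦ by
    simp [hg, mul_smul]
  simp only [hQ] at hunb
  have hgb : g • b = I := by rw [hg, mul_smul, hfI, hk]
  have hmem : ∀ n, ∀ q ∈ O, (g * γ n) • q ∈ g • O := fun n q hq ↦ by
    rw [mul_smul]
    exact Set.smul_mem_smul_set ((hγ n q).2 hq)
  obtain ⟨l, hl, him, hper, hre⟩ := exists_translation_of_visible (h.smul g)
    (hgb ▸ Set.smul_mem_smul_set hb) hunb (fun n ↦ by
      obtain ⟨q, hq, q', hq', hqq⟩ := hvis n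
      exact ⟨_, hmem n q hq, _, hmem n q' hq', visible_ineq_smul _ hqq⟩)
    (fun n ↦ by
      rintro _ ⟨q, hq, rfl⟩
      rw [← hgb, ← hγo n]
      simp only [← mul_smul]
      rw [dist_smul]
      refine (hmin n _ ((hγ n).inv q |>.2 hq)).trans_eq ?_
      rw [← dist_smul (g * γ n), mul_smul g (γ n) ((γ n)⁻¹ • q), smul_inv_smul])
  have hframe : CuspFrame O g l :=
    { le_one := fun q hq ↦ him _ (Set.smul_mem_smul_set hq)
      attained := ⟨b, hb, by rw [hgb, I_im]⟩
      ne_zero := hl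
      periodic := fun w ↦ by
        rw [← Set.mem_smul_set_iff_inv_smul_mem, hper]
        exact Set.smul_mem_smul_set_iff }
  obtain ⟨n, hn⟩ := hunb (|l| + K * (1 + l ^ 2))
  have h1 := hcusp n _ l (hframe.mul (hγ n))
  have h2 := Complex.norm_le_abs_re_add_abs_im (((g * γ n) • p n : ℍ) : ℂ)
  simp only [coe_re, coe_im, abs_of_pos ((g * γ n) • p n).im_pos] at h2
  linarith [hre n]

/-! ### The limit set and its gaps -/

/-- The finite part of the limit set of `O`. -/
def limitSet (O : Set ℍ) : Set ℝ := {x : ℝ | (x : ℂ) ∈ closure ((↑) '' O : Set ℂ)}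

lemma isClosed_limitSet (O : Set ℍ) : IsClosed (limitSet O) :=
  isClosed_closure.preimage Complex.continuous_ofReal

lemma mem_limitSet_iff {O : Set ℍ} {x : ℝ} :
    x ∈ limitSet O ↔ ∀ e > 0, ∃ o ∈ O, ‖(o : ℂ) - x‖ < e := by
  change (x : ℂ) ∈ closure ((↑) '' O : Set ℂ) ↔ _
  rw [Metric.mem_closure_iff]
  simp [Complex.dist_eq, norm_sub_rev]

lemma entries_inv (g : SL(2, ℝ)) :
    g⁻¹ 0 0 = g 1 1 ∧ g⁻¹ 0 1 = - g 0 1 ∧ g⁻¹ 1 0 = - g 1 0 ∧ g⁻¹ 1 1 = g 0 0 := by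
  simp [Matrix.SpecialLinearGroup.coe_inv, Matrix.adjugate_fin_two]

lemma moebius_den {a b c d x : ℝ} (hdet : a * d - b * c = 1) (hx : c * x + d ≠ 0) :
    a - c * ((a * x + b) / (c * x + d)) = 1 / (c * x + d) := by
  rw [eq_div_iff hx, sub_mul, mul_assoc, div_mul_cancel₀ _ hx]
  linear_combination hdet

lemma moebius_inv {a b c d x : ℝ} (hdet : a * d - b * c = 1) (hx : c * x + d ≠ 0) :
    (d * ((a * x + b) / (c * x + d)) - b) / (a - c * ((a * x + b) / (c * x + d))) = x := by
  rw [moebius_den hdet hx, div_div_eq_mul_div, div_one, sub_mul, mul_assoc,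
    div_mul_cancel₀ _ hx]
  linear_combination x * hdet

/-- The boundary value of the Möbius action. -/
lemma tendsto_coe_smul {ι : Type*} {f : Filter ι} {g : ι → SL(2, ℝ)} {h : SL(2, ℝ)} {w : ι → ℍ}
    {y : ℝ} (hg : Tendsto g f (𝓝 h)) (hw : Tendsto (fun i ↦ (w i : ℂ)) f (𝓝 (y : ℂ)))
    (hy : h 1 0 * y + h 1 1 ≠ 0) :
    Tendsto (fun i ↦ ((g i • w i : ℍ) : ℂ)) f
      (𝓝 (((h 0 0 * y + h 0 1) / (h 1 0 * y + h 1 1) : ℝ) : ℂ)) := by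
  have he : ∀ a b, Tendsto (fun i ↦ ((g i a b : ℝ) : ℂ)) f (𝓝 ((h a b : ℝ) : ℂ)) := fun a b ↦
    ((Complex.continuous_ofReal.comp (continuous_entry a b)).tendsto h).comp hg
  simp only [coe_smul_eq]
  push_cast
  refine (((he 0 0).mul hw).add (he 0 1)).div (((he 1 0).mul hw).add (he 1 1)) ?_
  exact_mod_cast hy

lemma mem_limitSet_of_smul {O : Set ℍ} {g : SL(2, ℝ)} (hg : Preserves g O) {x : ℝ}
    (hx : g 1 0 * x + g 1 1 ≠ 0)
    (h : (g 0 0 * x + g 0 1) / (g 1 0 * x + g 1 1) ∈ limitSet O) : x ∈ limitSet O := by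
  have hmem : (((g 0 0 * x + g 0 1) / (g 1 0 * x + g 1 1) : ℝ) : ℂ) ∈
    closure ((↑) '' O : Set ℂ) := h
  obtain ⟨u, hu, hlim⟩ := mem_closure_iff_seq_limit.1 hmem
  choose w hw hwu using hu
  obtain ⟨i1, i2, i3, i4⟩ := entries_inv g
  have hdet := det_eq_one g
  have hden := moebius_den hdet hx
  have hval := moebius_inv hdet hx
  set y := (g 0 0 * x + g 0 1) / (g 1 0 * x + g 1 1) with hy
  have hne : g⁻¹ 1 0 * y + g⁻¹ 1 1 = g 0 0 - g 1 0 * y := by rw [i3, i4]; ring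
  have hlim' : Tendsto (fun n ↦ (w n : ℂ)) atTop (𝓝 (y : ℂ)) := by simpa only [hwu] using hlim
  have := tendsto_coe_smul (tendsto_const_nhds (x := g⁻¹)) hlim' (by rw [hne, hden]; positivity)
  rw [hne, i1, i2, ← sub_eq_add_neg, hval] at this
  exact mem_closure_of_tendsto this
    (Eventually.of_forall fun n ↦ ⟨_, (hg.inv (w n)).2 (hw n), rfl⟩)

lemma exists_le_linear (x₁ x₂ : ℝ) (hx : x₁ ≠ x₂) (b : ℂ) : ∃ κ > 0, ∀ c d : ℝ,
    κ * ‖(c * b + d : ℂ)‖ ≤ |c * x₁ + d| ∨ κ * ‖(c * b + d : ℂ)‖ ≤ |c * x₂ + d| := by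
  set A := ‖b - x₁‖ / |x₂ - x₁| with hA
  have hA0 : 0 ≤ A := by positivity
  refine ⟨1 / (1 + 2 * A), by positivity, fun c d ↦ ?_⟩
  by_contra! hcon
  obtain ⟨h1, h2⟩ := hcon
  have hx' : 0 < |x₂ - x₁| := abs_pos.2 (sub_ne_zero.2 hx.symm)
  have hc : |c| * |x₂ - x₁| ≤ |c * x₁ + d| + |c * x₂ + d| := by
    rw [← abs_mul]
    calc |c * (x₂ - x₁)| = |(c * x₂ + d) - (c * x₁ + d)| := by ring_nf
      _ ≤ |c * x₂ + d| + |c * x₁ + d| := abs_sub _ _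
      _ = _ := add_comm _ _
  have hn : ‖(c * b + d : ℂ)‖ ≤ |c * x₁ + d| + |c| * ‖b - x₁‖ := by
    calc ‖(c * b + d : ℂ)‖ = ‖((c * x₁ + d : ℝ) : ℂ) + (c : ℂ) * (b - x₁)‖ := by
          push_cast; ring_nf
      _ ≤ _ := by
          refine (norm_add_le _ _).trans ?_
          rw [norm_mul, Complex.norm_real, Complex.norm_real, Real.norm_eq_abs, Real.norm_eq_abs]
  have hbA : ‖b - x₁‖ = A * |x₂ - x₁| := by rw [hA]; field_simp
  rw [hbA] at hn
  have h3 : |c| * (A * |x₂ - x₁|) ≤ A * (|c * x₁ + d| + |c * x₂ + d|) := by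
    calc |c| * (A * |x₂ - x₁|) = A * (|c| * |x₂ - x₁|) := by ring
      _ ≤ _ := by gcongr
  have h4 : A * (|c * x₁ + d| + |c * x₂ + d|) ≤
      A * (1 / (1 + 2 * A) * ‖(c * b + d : ℂ)‖ + 1 / (1 + 2 * A) * ‖(c * b + d : ℂ)‖) := by
    gcongr
  have h5 : (1 + 2 * A) * (1 / (1 + 2 * A) * ‖(c * b + d : ℂ)‖) = ‖(c * b + d : ℂ)‖ := by
    field_simp
  linarith

/-- A limit set which is not all of `ℝ` contains no interval. -/
lemma not_ball_subset_limitSet {O : Set ℍ} (h : IsNet O) (hne : limitSet O ≠ Set.univ)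
    (t ρ : ℝ) (hρ : 0 < ρ) : ¬ Metric.ball t ρ ⊆ limitSet O := by
  intro hsub
  obtain ⟨x₁, hx₁⟩ := (Set.ne_univ_iff_exists_notMem _).1 hne
  obtain ⟨e, he, hball⟩ := Metric.isOpen_iff.1 (isClosed_limitSet O).isOpen_compl x₁ hx₁
  have hx₂ : x₁ + e / 2 ∉ limitSet O := hball (by
    rw [Metric.mem_ball, Real.dist_eq, add_sub_cancel_left, abs_of_pos (by positivity)]
    linarith)
  set x₂ := x₁ + e / 2 with hx₂_def
  obtain ⟨b, hb⟩ := h.nonempty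
  obtain ⟨κ, hκ, hlin⟩ := exists_le_linear x₁ x₂ (by rw [hx₂_def]; linarith) b
  have hbim := b.im_pos
  set B := ‖(x₁ : ℂ) - b‖ + ‖(x₂ : ℂ) - b‖ with hB
  have hB0 : 0 ≤ B := by positivity
  set η := ρ / (1 + B / (κ * b.im)) with hη
  have hη0 : 0 < η := by positivity
  obtain ⟨o, ho, hot⟩ := mem_limitSet_iff.1 (hsub (Metric.mem_ball_self hρ)) η hη0
  obtain ⟨g, hg, rfl⟩ := h.transitive b hb o ho
  have hden := norm_pos_iff.2 (den_ne_zero g b)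
  have himlt : b.im < η * ‖(g 1 0 * b + g 1 1 : ℂ)‖ ^ 2 := by
    have h1 : (g • b).im < η := by
      have := (Complex.abs_im_le_norm (((g • b : ℍ) : ℂ) - t)).trans_lt hot
      simpa [abs_of_pos (g • b).im_pos] using this
    rwa [im_smul_eq, div_lt_iff₀ (by positivity)] at h1
  have key : ∀ x : ℝ, ‖(x : ℂ) - b‖ ≤ B → κ * ‖(g 1 0 * b + g 1 1 : ℂ)‖ ≤ |g 1 0 * x + g 1 1| →
      x ∈ limitSet O := by
    intro x hxB hx
    have hx0 : 0 < |g 1 0 * x + g 1 1| := lt_of_lt_of_le (by positivity) hx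
    have hx0' : g 1 0 * x + g 1 1 ≠ 0 := abs_pos.1 hx0
    refine mem_limitSet_of_smul hg hx0' (hsub ?_)
    rw [Metric.mem_ball, Real.dist_eq, ← Real.norm_eq_abs, ← Complex.norm_real]
    have hx0c : (g 1 0 * x + g 1 1 : ℂ) ≠ 0 := mod_cast hx0'
    have hdiff : (((g 0 0 * x + g 0 1) / (g 1 0 * x + g 1 1) : ℝ) : ℂ) - (g • b : ℍ) =
        ((x : ℂ) - b) / (((g 1 0 * x + g 1 1 : ℝ) : ℂ) * (g 1 0 * b + g 1 1)) := by
      have hd : (g 0 0 * g 1 1 - g 0 1 * g 1 0 : ℂ) = 1 := mod_cast det_eq_one g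
      push_cast
      rw [coe_smul_eq, div_sub_div _ _ hx0c (den_ne_zero g b)]
      congr 1
      linear_combination ((x : ℂ) - b) * hd
    have hle : ‖(((g 0 0 * x + g 0 1) / (g 1 0 * x + g 1 1) : ℝ) : ℂ) - (g • b : ℍ)‖ ≤
        B / (κ * b.im) * η := by
      rw [hdiff, norm_div, norm_mul, Complex.norm_real, Real.norm_eq_abs]
      calc ‖(x : ℂ) - b‖ / (|g 1 0 * x + g 1 1| * ‖(g 1 0 * b + g 1 1 : ℂ)‖)
          ≤ B / (κ * ‖(g 1 0 * b + g 1 1 : ℂ)‖ * ‖(g 1 0 * b + g 1 1 : ℂ)‖) := by gcongr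
        _ ≤ B / (κ * (b.im / η)) := by
          rw [mul_assoc, ← pow_two]
          gcongr
          rw [div_le_iff₀ hη0]
          linarith
        _ = _ := by field_simp
    calc ‖(((g 0 0 * x + g 0 1) / (g 1 0 * x + g 1 1) - t : ℝ) : ℂ)‖
        = ‖((((g 0 0 * x + g 0 1) / (g 1 0 * x + g 1 1) : ℝ) : ℂ) - (g • b : ℍ)) +
          ((g • b : ℍ) - t)‖ := by push_cast; ring_nf
      _ ≤ _ := norm_add_le _ _
      _ < B / (κ * b.im) * η + η := by linarith
      _ = ρ := by rw [hη]; field_simp; ring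
  rcases hlin (g 1 0) (g 1 1) with h1 | h1
  · exact hx₁ (key x₁ (le_add_of_nonneg_right (norm_nonneg _)) h1)
  · exact hx₂ (key x₂ (le_add_of_nonneg_left (norm_nonneg _)) h1)

lemma isCompact_dist_smul_I_le (D : ℝ) : IsCompact {g : SL(2, ℝ) | dist (g • I) I ≤ D} :=
  isProperMap_smul_I.isCompact_preimage (isCompact_closedBall I D)

/-- Near every point of a bounded neighbourhood of the net there is a gap of the limit set of
comparable size. -/
lemma exists_gap {O : Set ℍ} (h : IsNet O) (hne : limitSet O ≠ Set.univ) (D : ℝ) :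
    ∃ δ > 0, ∀ p : ℍ, (∃ o ∈ O, dist p o ≤ D) →
      ∃ t : ℝ, |t - p.re| < p.im / 2 ∧ ∀ o ∈ O, δ * p.im ≤ ‖(o : ℂ) - t‖ := by
  by_contra! hcon
  choose p hp hdense using fun n : ℕ ↦ hcon (1 / (n + 1)) (by positivity)
  choose o ho hpo using hp
  obtain ⟨b, hb⟩ := h.nonempty
  choose γ hγ hγb using fun n ↦ h.transitive b hb (o n) (ho n)
  obtain ⟨k, -, φ, hφ, hlim⟩ := (isCompact_dist_smul_I_le (D + dist I b)).tendsto_subseq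
    (x := fun n ↦ (p n).toSL2R⁻¹ * γ n) (fun n ↦ by
      change dist (((p n).toSL2R⁻¹ * γ n) • I) I ≤ _
      refine (dist_triangle_left _ _ (((p n).toSL2R⁻¹ * γ n) • b)).trans ?_
      rw [dist_smul, dist_comm b, add_comm]
      gcongr
      rw [mul_smul, hγb, ← toSL2R_inv_smul_self (p n), dist_smul, dist_comm]
      exact hpo n)
  have hlim' := hlim.inv
  have hcoe : ∀ (n : ℕ) (w : ℍ), ((p n).toSL2R⁻¹ • w : ℍ) = ((w : ℂ) - (p n).re) / (p n).im := by
    intro n w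
    have h1 := coe_toSL2R_smul (p n) ((p n).toSL2R⁻¹ • w)
    rw [smul_inv_smul] at h1
    have h2 : ((p n).im : ℂ) ≠ 0 := mod_cast (p n).im_pos.ne'
    rw [h1]
    field_simp
    ring
  have key : ∀ t : ℝ, |t| < 1 / 2 → k⁻¹ 1 0 * t + k⁻¹ 1 1 ≠ 0 →
      (k⁻¹ 0 0 * t + k⁻¹ 0 1) / (k⁻¹ 1 0 * t + k⁻¹ 1 1) ∈ limitSet O := by
    intro t ht hne
    choose q hq hqt using fun n ↦ hdense n ((p n).im * t + (p n).re) (by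
      have h1 := (p n).im_pos
      rw [add_sub_cancel_right, abs_mul, abs_of_pos h1]
      have : (p n).im * |t| < (p n).im * (1 / 2) := by gcongr
      linarith)
    have hw : Tendsto (fun n ↦ (((p n).toSL2R⁻¹ • q n : ℍ) : ℂ)) atTop (𝓝 (t : ℂ)) := by
      rw [tendsto_iff_norm_sub_tendsto_zero]
      refine squeeze_zero (fun n ↦ norm_nonneg _) (fun n ↦ ?_)
        tendsto_one_div_add_atTop_nhds_zero_nat
      have h1 := (p n).im_pos
      have h2 : ((p n).im : ℂ) ≠ 0 := mod_cast h1.ne'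
      have h3 : ((q n : ℂ) - (p n).re) / (p n).im - t =
          ((q n : ℂ) - ((p n).im * t + (p n).re : ℝ)) / (p n).im := by
        push_cast
        field_simp
        ring
      rw [hcoe, h3, norm_div, Complex.norm_real, Real.norm_eq_abs, abs_of_pos h1,
        div_le_iff₀ h1]
      exact (hqt n).le
    have := tendsto_coe_smul hlim' (hw.comp hφ.tendsto_atTop) hne
    refine mem_closure_of_tendsto this (Eventually.of_forall fun n ↦ ⟨_, ?_, rfl⟩)
    simp only [Function.comp_apply, mul_inv_rev, inv_inv, mul_smul, smul_inv_smul]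
    exact ((hγ (φ n)).inv _).2 (hq (φ n))
  clear hcon
  generalize k⁻¹ = m at key
  have hdet := det_eq_one m
  obtain ⟨t₀, ht₀, hne₀⟩ : ∃ t₀ : ℝ, |t₀| < 1 / 2 ∧ m 1 0 * t₀ + m 1 1 ≠ 0 := by
    by_cases h0 : m 1 1 = 0
    · refine ⟨1 / 4, by norm_num [abs_of_pos], ?_⟩
      rw [h0]
      rw [h0] at hdet
      intro h1
      have : m 1 0 = 0 := by linarith
      rw [this] at hdet
      norm_num at hdet
    · exact ⟨0, by norm_num, by simpa using h0⟩
  set y₀ := (m 0 0 * t₀ + m 0 1) / (m 1 0 * t₀ + m 1 1) with hy₀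
  have hden₀ : m 0 0 - m 1 0 * y₀ = 1 / (m 1 0 * t₀ + m 1 1) :=
    moebius_den hdet hne₀
  have hden_ne : m 0 0 - m 1 0 * y₀ ≠ 0 := by rw [hden₀]; positivity
  have hcont : ContinuousAt (fun y : ℝ ↦ (m 1 1 * y - m 0 1) / (m 0 0 - m 1 0 * y)) y₀ := by
    refine ContinuousAt.div ?_ ?_ hden_ne <;> fun_prop
  have hval : (m 1 1 * y₀ - m 0 1) / (m 0 0 - m 1 0 * y₀) = t₀ :=
    moebius_inv hdet hne₀
  have ev1 : ∀ᶠ y in 𝓝 y₀, |(m 1 1 * y - m 0 1) / (m 0 0 - m 1 0 * y)| < 1 / 2 := by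
    have := hcont.abs
    exact this.eventually_lt_const (by simpa only [hval] using ht₀)
  have ev2 : ∀ᶠ y in 𝓝 y₀, m 0 0 - m 1 0 * y ≠ 0 := by
    have : ContinuousAt (fun y : ℝ ↦ m 0 0 - m 1 0 * y) y₀ := by fun_prop
    exact this.eventually_ne hden_ne
  obtain ⟨ρ, hρ, hball⟩ := Metric.eventually_nhds_iff_ball.1 (ev1.and ev2)
  refine not_ball_subset_limitSet h hne y₀ ρ hρ fun y hy ↦ ?_
  obtain ⟨hy1, hy2⟩ := hball y hy
  have hdet' : m 1 1 * m 0 0 - -m 0 1 * -m 1 0 = 1 := by linarith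
  have hy2' : -m 1 0 * y + m 0 0 ≠ 0 := by rwa [neg_mul, neg_add_eq_sub]
  have hd := moebius_den hdet' hy2'
  have hv := moebius_inv hdet' hy2'
  have e1 : (m 1 1 * y + -m 0 1) / (-m 1 0 * y + m 0 0) =
      (m 1 1 * y - m 0 1) / (m 0 0 - m 1 0 * y) := by
    rw [neg_mul, neg_add_eq_sub, ← sub_eq_add_neg]
  rw [e1] at hd hv
  have := key _ hy1 (by
    rw [add_comm, ← sub_neg_eq_add, ← neg_mul, hd]
    positivity)
  convert this using 1
  refine hv.symm.trans ?_
  congr 1 <;> ring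

end FuchsianLimit

namespace FuchsianLimit

open Filter Topology MeasureTheory
open scoped ENNReal

/-! ### Dyadic cells and a dimension estimate -/

/-- The index of the dyadic interval of length `2⁻ⁿ` containing `x`. -/
noncomputable def idx (n : ℕ) (x : ℝ) : ℤ := ⌊x * 2 ^ n⌋

lemma idx_eq_iff {n : ℕ} {x : ℝ} {k : ℤ} :
    idx n x = k ↔ x ∈ Set.Ico (k / 2 ^ n : ℝ) ((k + 1) / 2 ^ n) := by
  rw [idx, Int.floor_eq_iff, Set.mem_Ico, div_le_iff₀ (by positivity), lt_div_iff₀ (by positivity)]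

lemma idx_eq_idx_div (n j : ℕ) (x : ℝ) : idx n x = idx (n + j) x / (2 ^ j : ℕ) := by
  rw [idx, idx, ← Int.floor_div_natCast]
  congr 1
  push_cast
  rw [pow_add]
  field_simp

lemma idx_congr {n n' : ℕ} (h : n ≤ n') {x y : ℝ} (hxy : idx n' x = idx n' y) :
    idx n x = idx n y := by
  obtain ⟨j, rfl⟩ := Nat.exists_eq_add_of_le h
  rw [idx_eq_idx_div n j, idx_eq_idx_div n j y, hxy]

lemma setOf_idx_eq (n : ℕ) (k : ℤ) :
    {x | idx n x = k} = Set.Ico (k / 2 ^ n : ℝ) ((k + 1) / 2 ^ n) := by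
  ext x
  exact idx_eq_iff

lemma volume_setOf_idx_eq (n : ℕ) (k : ℤ) :
    volume {x | idx n x = k} = ENNReal.ofReal ((1 / 2) ^ n) := by
  rw [setOf_idx_eq, Real.volume_Ico]
  congr 1
  rw [← sub_div, add_sub_cancel_left, one_div_pow]

lemma ediam_setOf_idx_eq (n : ℕ) (k : ℤ) :
    Metric.ediam {x | idx n x = k} = ENNReal.ofReal ((1 / 2) ^ n) := by
  rw [setOf_idx_eq, Real.ediam_Ico]
  congr 1
  rw [← sub_div, add_sub_cancel_left, one_div_pow]

lemma exists_contraction_exponent (m : ℕ) (C : ℝ) (hC : 0 ≤ C) :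
    ∃ q : ℝ, 1 / 2 < q ∧ q < 1 ∧ ∀ (a : ℕ → ℝ) (J : ℕ), (∀ j, 0 ≤ a j) →
      (∀ j, a j ≤ C * (3 / 2) ^ j) →
      ∑ j ∈ Finset.range J, a j * (1 / 2) ^ j ≤ 1 - (1 / 2) ^ m →
      ∑ j ∈ Finset.range J, a j * q ^ j ≤ 1 := by
  have hη : (0 : ℝ) < (1 / 2) ^ m / 2 := by positivity
  have hsum : Summable fun j : ℕ ↦ C * (9 / 10 : ℝ) ^ j :=
    (summable_geometric_of_lt_one (by norm_num) (by norm_num)).mul_left C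
  obtain ⟨s, hs⟩ := summable_iff_vanishing_norm.1 hsum _ hη
  set M := s.sup id + 1 with hM
  have hcont : Tendsto (fun q : ℝ ↦ (2 * q) ^ M * (1 - (1 / 2) ^ m)) (𝓝[>] (1 / 2))
      (𝓝 ((2 * (1 / 2)) ^ M * (1 - (1 / 2) ^ m))) := by
    apply Tendsto.mono_left _ nhdsWithin_le_nhds
    exact Continuous.tendsto (by fun_prop) _
  have hlt : ((2 * (1 / 2 : ℝ)) ^ M * (1 - (1 / 2) ^ m)) < 1 - (1 / 2) ^ m / 2 := by
    rw [mul_one_div_cancel two_ne_zero, one_pow, one_mul]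
    linarith
  have h35 : ∀ᶠ q : ℝ in 𝓝[>] (1 / 2), q < 3 / 5 :=
    nhdsWithin_le_nhds (eventually_lt_nhds (by norm_num))
  obtain ⟨q, hq1, hq2, hq3⟩ := ((hcont.eventually_lt_const hlt).and
    (h35.and self_mem_nhdsWithin)).exists
  have hq3 : 1 / 2 < q := hq3
  refine ⟨q, hq3, by linarith, fun a J ha0 haC hsumle ↦ ?_⟩
  have hterm : ∀ j, a j * q ^ j ≤ (2 * q) ^ M * (a j * (1 / 2) ^ j) +
      if M ≤ j then C * (9 / 10) ^ j else 0 := by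
    intro j
    have e : a j * q ^ j = (2 * q) ^ j * (a j * (1 / 2) ^ j) := by
      rw [mul_pow, one_div_pow]
      field_simp
    split_ifs with hj
    · have h1 : a j * q ^ j ≤ C * (3 / 2) ^ j * (3 / 5) ^ j := by
        gcongr
        exact haC j
      rw [mul_assoc, ← mul_pow] at h1
      norm_num at h1
      have h2 : 0 ≤ (2 * q) ^ M * (a j * (1 / 2) ^ j) := by
        have := ha0 j
        positivity
      linarith
    · rw [e, add_zero]
      have := ha0 j
      gcongr
      · linarith
      · omega
  have htail : ∑ j ∈ Finset.range J, (if M ≤ j then C * (9 / 10 : ℝ) ^ j else 0) ≤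
      (1 / 2) ^ m / 2 := by
    rw [← Finset.sum_filter]
    refine (le_abs_self _).trans (hs _ ?_).le
    rw [Finset.disjoint_left]
    intro j hj hjs
    have := Finset.le_sup (f := id) hjs
    simp only [Finset.mem_filter, id_eq] at hj this
    omega
  calc ∑ j ∈ Finset.range J, a j * q ^ j
      ≤ ∑ j ∈ Finset.range J, ((2 * q) ^ M * (a j * (1 / 2) ^ j) +
        if M ≤ j then C * (9 / 10) ^ j else 0) := Finset.sum_le_sum fun j _ ↦ hterm j
    _ = (2 * q) ^ M * ∑ j ∈ Finset.range J, a j * (1 / 2) ^ j +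
        ∑ j ∈ Finset.range J, (if M ≤ j then C * (9 / 10 : ℝ) ^ j else 0) := by
        rw [Finset.sum_add_distrib, Finset.mul_sum]
    _ ≤ (2 * q) ^ M * (1 - (1 / 2) ^ m) + (1 / 2) ^ m / 2 := by gcongr
    _ ≤ 1 := by linarith

/-- Combinatorial control of a set of reals by a family `T` of marked dyadic cells. -/
structure CellControl (L : Set ℝ) (T : ℕ → ℤ → Prop) (N m : ℕ) (C : ℝ) : Prop where
  one_le : 1 ≤ m
  nonneg : 0 ≤ C
  /-- A marked cell has a subcell, `m` levels below, missing `L`. -/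
  gap : ∀ n k, N ≤ n → T n k → ∃ k', (∀ x, idx (n + m) x = k' → idx n x = k) ∧
    ∀ x ∈ L, idx (n + m) x ≠ k'
  /-- There are few long chains of unmarked cells below a marked one. -/
  count : ∀ n k, N ≤ n → T n k → ∀ j, m ≤ j → ∀ S : Finset ℤ,
    (∀ k' ∈ S, ∃ x ∈ L, idx n x = k ∧ idx (n + j) x = k' ∧
      ∀ i, m ≤ i → i < j → ¬ T (n + i) (idx (n + i) x)) → (S.card : ℝ) ≤ C * (3 / 2) ^ j
  countable : {x ∈ L | ∀ᶠ n in atTop, ¬ T n (idx n x)}.Countable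

/-- The first marked cells at relative level `j ≥ m` below `(n, k)`. -/
def children (L : Set ℝ) (T : ℕ → ℤ → Prop) (m n : ℕ) (k : ℤ) (j : ℕ) : Set ℤ :=
  {k' | m ≤ j ∧ T (n + j) k' ∧ ∃ x ∈ L, idx n x = k ∧ idx (n + j) x = k' ∧
      ∀ i, m ≤ i → i < j → ¬ T (n + i) (idx (n + i) x)}

namespace CellControl

variable {L : Set ℝ} {T : ℕ → ℤ → Prop} {N m : ℕ} {C : ℝ}

lemma card_children_le (h : CellControl L T N m C) {n : ℕ} {k : ℤ} (hn : N ≤ n) (hT : T n k)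
    (j : ℕ) (S : Finset ℤ) (hS : (S : Set ℤ) ⊆ children L T m n k j) :
    (S.card : ℝ) ≤ C * (3 / 2) ^ j := by
  by_cases hj : m ≤ j
  · exact h.count n k hn hT j hj S fun k' hk' ↦ (hS hk').2.2
  · have : S = ∅ := Finset.eq_empty_of_forall_notMem fun k' hk' ↦ hj (hS hk').1
    have := h.nonneg
    simp only [‹S = ∅›, Finset.card_empty, Nat.cast_zero]
    positivity

lemma finite_children (h : CellControl L T N m C) {n : ℕ} {k : ℤ} (hn : N ≤ n) (hT : T n k)
    (j : ℕ) : (children L T m n k j).Finite := by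
  by_contra hinf
  obtain ⟨B, hB⟩ := exists_nat_gt (C * (3 / 2) ^ j)
  obtain ⟨S, hS, hcard⟩ := Set.Infinite.exists_subset_card_eq hinf B
  have := h.card_children_le hn hT j S hS
  rw [hcard] at this
  linarith

lemma sum_children_le (h : CellControl L T N m C) {n : ℕ} {k : ℤ} (hn : N ≤ n) (hT : T n k)
    (J : ℕ) : ∑ j ∈ Finset.range J,
      ((h.finite_children hn hT j).toFinset.card : ℝ) * (1 / 2) ^ j ≤ 1 - (1 / 2) ^ m := by
  obtain ⟨k₀, hk₀, hk₀L⟩ := h.gap n k hn hT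
  set Ch := fun j ↦ (h.finite_children hn hT j).toFinset with hCh
  set P : Finset ((_ : ℕ) × ℤ) := (Finset.range J).sigma Ch with hP
  have hmem : ∀ p ∈ P, p.2 ∈ children L T m n k p.1 := by
    intro p hp
    simpa [hCh] using (Finset.mem_sigma.1 hp).2
  set f : (_ : ℕ) × ℤ → Set ℝ := fun p ↦ {x | idx (n + p.1) x = p.2} with hf
  have hmeas : ∀ (n : ℕ) (k : ℤ), MeasurableSet {x | idx n x = k} := fun n k ↦ by
    rw [setOf_idx_eq]; exact measurableSet_Ico
  have hlev : ∀ p ∈ P, ∀ q ∈ P, ∀ y, y ∈ f p → y ∈ f q → p.1 ≤ q.1 → p = q := by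
    rintro ⟨j, k₁⟩ hp ⟨j', k₂⟩ hq y hyp hyq hjj
    obtain ⟨hj, hTp, -⟩ := hmem _ hp
    obtain ⟨hj', -, x, hxL, hxk, hxk', hx⟩ := hmem _ hq
    simp only [hf, Set.mem_ofPred_eq] at hyp hyq hjj hj hj' hTp hxk' hx
    have e : idx (n + j) x = idx (n + j) y := idx_congr (by omega) (hxk'.trans hyq.symm)
    rcases hjj.eq_or_lt with rfl | hlt
    · rw [← hyp, ← hyq]
    · exact absurd (by rw [e, hyp]; exact hTp) (hx j hj hlt)
  have hdisj : (P : Set ((_ : ℕ) × ℤ)).PairwiseDisjoint f := by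
    intro p hp q hq hpq
    refine Set.disjoint_left.2 fun y hy hy' ↦ hpq ?_
    rcases le_total p.1 q.1 with hle | hle
    · exact hlev p hp q hq y hy hy' hle
    · exact (hlev q hq p hp y hy' hy hle).symm
  have hdisj0 : Disjoint (⋃ p ∈ P, f p) {x | idx (n + m) x = k₀} := by
    rw [Set.disjoint_left]
    rintro y hy hy0
    obtain ⟨p, hp, hyp⟩ := Set.mem_iUnion₂.1 hy
    obtain ⟨hj, -, x, hxL, -, hxk', -⟩ := hmem _ hp
    refine hk₀L x hxL ?_
    rw [← show idx (n + m) y = k₀ from hy0]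
    refine idx_congr (n' := n + p.1) (by omega) (hxk'.trans ?_)
    exact Eq.symm hyp
  have hsub : (⋃ p ∈ P, f p) ∪ {x | idx (n + m) x = k₀} ⊆ {x | idx n x = k} := by
    rintro y (hy | hy)
    · obtain ⟨p, hp, hyp⟩ := Set.mem_iUnion₂.1 hy
      obtain ⟨-, -, x, -, hxk, hxk', -⟩ := hmem _ hp
      change idx n y = k
      rw [← hxk]
      exact idx_congr (n' := n + p.1) (by omega) (Eq.trans hyp hxk'.symm)
    · exact hk₀ y hy
  have hvol := measure_mono (μ := volume) hsub
  rw [measure_union hdisj0 (hmeas _ _), measure_biUnion_finset hdisj (fun p _ ↦ hmeas _ _)] at hvol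
  simp only [hf, volume_setOf_idx_eq] at hvol
  rw [hP, Finset.sum_sigma] at hvol
  have e : ∑ j ∈ Finset.range J, ∑ _s ∈ Ch j, ENNReal.ofReal ((1 / 2) ^ (n + j)) =
      ENNReal.ofReal (∑ j ∈ Finset.range J, ((Ch j).card : ℝ) * (1 / 2) ^ (n + j)) := by
    rw [ENNReal.ofReal_sum_of_nonneg fun j _ ↦ by positivity]
    refine Finset.sum_congr rfl fun j _ ↦ ?_
    rw [Finset.sum_const, nsmul_eq_mul, ENNReal.ofReal_mul (Nat.cast_nonneg _),
      ENNReal.ofReal_natCast]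
  rw [e, ← ENNReal.ofReal_add (Finset.sum_nonneg fun j _ ↦ by positivity) (by positivity),
    ENNReal.ofReal_le_ofReal_iff (by positivity)] at hvol
  have e2 : ∑ j ∈ Finset.range J, ((Ch j).card : ℝ) * (1 / 2) ^ (n + j) =
      (1 / 2) ^ n * ∑ j ∈ Finset.range J, ((Ch j).card : ℝ) * (1 / 2) ^ j := by
    rw [Finset.mul_sum]
    refine Finset.sum_congr rfl fun j _ ↦ ?_
    ring
  rw [e2, pow_add, ← mul_add] at hvol
  have := le_of_mul_le_mul_left (hvol.trans_eq (mul_one _).symm) (by positivity)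
  linarith

/-- The points of `L` lying in infinitely many marked cells. -/
def recurrentSet (L : Set ℝ) (T : ℕ → ℤ → Prop) : Set ℝ :=
  {x ∈ L | ∃ᶠ n in atTop, T n (idx n x)}

lemma recurrentSet_inter_subset (h : CellControl L T N m C) {n : ℕ} {k : ℤ} (hn : N ≤ n)
    (hT : T n k) : recurrentSet L T ∩ {x | idx n x = k} ⊆
      ⋃ j, ⋃ k' ∈ (h.finite_children hn hT j).toFinset,
        recurrentSet L T ∩ {x | idx (n + j) x = k'} := by
  classical
  rintro x ⟨⟨hxL, hx⟩, hxk⟩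
  have hex : ∃ j, m ≤ j ∧ T (n + j) (idx (n + j) x) := by
    obtain ⟨b, hb, hTb⟩ := (frequently_atTop.1 hx) (n + m)
    exact ⟨b - n, by omega, by rwa [Nat.add_sub_cancel' (by omega)]⟩
  have hmin : ∀ i, m ≤ i → i < Nat.find hex → ¬ T (n + i) (idx (n + i) x) :=
    fun i hi hlt hTi ↦ Nat.find_min hex hlt ⟨hi, hTi⟩
  obtain ⟨h1, h2⟩ := Nat.find_spec hex
  refine Set.mem_iUnion.2 ⟨Nat.find hex, Set.mem_iUnion₂.2 ⟨idx _ x, ?_, ⟨hxL, hx⟩, rfl⟩⟩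
  rw [Set.Finite.mem_toFinset]
  exact ⟨h1, h2, x, hxL, hxk, rfl, hmin⟩

lemma pre_recurrentSet_le (h : CellControl L T N m C) {q s : ℝ} (hq0 : 0 < q)
    (hqs : (1 / 2 : ℝ) ^ s = q)
    (hq : ∀ (a : ℕ → ℝ) (J : ℕ), (∀ j, 0 ≤ a j) → (∀ j, a j ≤ C * (3 / 2) ^ j) →
      ∑ j ∈ Finset.range J, a j * (1 / 2) ^ j ≤ 1 - (1 / 2) ^ m →
      ∑ j ∈ Finset.range J, a j * q ^ j ≤ 1) (r : ℝ≥0∞) (t : ℕ) :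
    ∀ (n : ℕ) (k : ℤ), N ≤ n → T n k → ENNReal.ofReal ((1 / 2) ^ (n + t)) ≤ r →
      OuterMeasure.mkMetric'.pre (fun A : Set ℝ ↦ Metric.ediam A ^ s) r
        (recurrentSet L T ∩ {x | idx n x = k}) ≤ ENNReal.ofReal (q ^ n) := by
  induction t with
  | zero =>
    intro n k _ _ hr
    calc _ ≤ OuterMeasure.mkMetric'.pre (fun A : Set ℝ ↦ Metric.ediam A ^ s) r
          {x | idx n x = k} := measure_mono Set.inter_subset_right
      _ ≤ Metric.ediam {x | idx n x = k} ^ s :=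
          OuterMeasure.mkMetric'.pre_le (by rwa [ediam_setOf_idx_eq])
      _ = ENNReal.ofReal (q ^ n) := by
          rw [ediam_setOf_idx_eq, ENNReal.ofReal_rpow_of_pos (by positivity), ← hqs,
            ← Real.rpow_natCast, ← Real.rpow_natCast, ← Real.rpow_mul (by norm_num),
            ← Real.rpow_mul (by norm_num), mul_comm]
  | succ t ih =>
    intro n k hn hT hr
    refine (measure_mono (h.recurrentSet_inter_subset hn hT)).trans ?_
    refine (measure_iUnion_le _).trans (ENNReal.tsum_le_of_sum_range_le fun J ↦ ?_)
    set Ch := fun j ↦ (h.finite_children hn hT j).toFinset with hCh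
    have hterm : ∀ j, OuterMeasure.mkMetric'.pre (fun A : Set ℝ ↦ Metric.ediam A ^ s) r
        (⋃ k' ∈ Ch j, recurrentSet L T ∩ {x | idx (n + j) x = k'}) ≤
        ENNReal.ofReal ((Ch j).card * q ^ (n + j)) := by
      intro j
      refine (measure_biUnion_finset_le _ _).trans ?_
      refine (Finset.sum_le_card_nsmul _ _ (ENNReal.ofReal (q ^ (n + j))) ?_).trans_eq ?_
      · intro k' hk'
        have hmem : k' ∈ children L T m n k j := by simpa [hCh] using hk'
        have := hmem.1
        have := h.one_le
        refine ih (n + j) k' (by omega) hmem.2.1 (le_trans ?_ hr)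
        refine ENNReal.ofReal_le_ofReal
          (pow_le_pow_of_le_one (by norm_num) (by norm_num) (by omega))
      · rw [nsmul_eq_mul, ENNReal.ofReal_mul (Nat.cast_nonneg _), ENNReal.ofReal_natCast]
    refine (Finset.sum_le_sum fun j _ ↦ hterm j).trans ?_
    rw [← ENNReal.ofReal_sum_of_nonneg fun j _ ↦ by positivity]
    refine ENNReal.ofReal_le_ofReal ?_
    have := hq (fun j ↦ (Ch j).card) J (fun j ↦ Nat.cast_nonneg _)
      (fun j ↦ h.card_children_le hn hT j _ (by simp [hCh])) (h.sum_children_le hn hT J)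
    calc ∑ j ∈ Finset.range J, ((Ch j).card : ℝ) * q ^ (n + j)
        = q ^ n * ∑ j ∈ Finset.range J, ((Ch j).card : ℝ) * q ^ j := by
          rw [Finset.mul_sum]
          refine Finset.sum_congr rfl fun j _ ↦ ?_
          ring
      _ ≤ q ^ n * 1 := by gcongr
      _ = q ^ n := mul_one _

theorem dimH_lt_one (h : CellControl L T N m C) : dimH L < 1 := by
  obtain ⟨q, hq1, hq2, hq⟩ := exists_contraction_exponent m C h.nonneg
  set s := Real.log q / Real.log (1 / 2) with hs
  have hlog : Real.log (1 / 2) < 0 := Real.log_neg (by norm_num) (by norm_num)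
  have hs0 : 0 < s := div_pos_of_neg_of_neg (Real.log_neg (by linarith) hq2) hlog
  have hs1 : s < 1 := by
    rw [hs, div_lt_one_of_neg hlog]
    exact Real.log_lt_log (by norm_num) hq1
  have hqs : (1 / 2 : ℝ) ^ s = q := by
    rw [Real.rpow_def_of_pos (by norm_num), hs, mul_div_cancel₀ _ hlog.ne,
      Real.exp_log (by linarith)]
  have hcell : ∀ n k, N ≤ n → T n k →
      dimH (recurrentSet L T ∩ {x | idx n x = k}) ≤ ENNReal.ofReal s := by
    intro n k hn hT
    refine dimH_le_of_hausdorffMeasure_ne_top (d := s.toNNReal) (ne_top_of_le_ne_top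
      (b := ENNReal.ofReal (q ^ n)) ENNReal.ofReal_ne_top ?_)
    rw [Real.coe_toNNReal _ hs0.le, Measure.hausdorffMeasure, ← Measure.coe_toOuterMeasure,
      Measure.mkMetric_toOuterMeasure, OuterMeasure.mkMetric, OuterMeasure.mkMetric']
    simp only [OuterMeasure.iSup_apply]
    refine iSup₂_le fun r hr ↦ ?_
    obtain ⟨t, ht⟩ : ∃ t : ℕ, ENNReal.ofReal ((1 / 2) ^ (n + t)) ≤ r := by
      have h1 : Tendsto (fun t : ℕ ↦ ENNReal.ofReal ((1 / 2) ^ (n + t))) atTop (𝓝 0) := by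
        rw [← ENNReal.ofReal_zero]
        refine ENNReal.tendsto_ofReal ?_
        have := tendsto_pow_atTop_nhds_zero_of_lt_one (r := (1 / 2 : ℝ)) (by norm_num)
          (by norm_num)
        exact this.comp (tendsto_atTop_mono (fun t ↦ Nat.le_add_left t n) tendsto_id)
      exact (h1.eventually_le_const hr).exists
    exact h.pre_recurrentSet_le (by linarith) hqs hq r t n k hn hT ht
  have hsub : L ⊆ {x ∈ L | ∀ᶠ n in atTop, ¬ T n (idx n x)} ∪
      ⋃ p : {p : ℕ × ℤ // N ≤ p.1 ∧ T p.1 p.2},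
        recurrentSet L T ∩ {x | idx p.1.1 x = p.1.2} := by
    intro x hx
    by_cases hxT : ∀ᶠ n in atTop, ¬ T n (idx n x)
    · exact Or.inl ⟨hx, hxT⟩
    · have hfreq : ∃ᶠ n in atTop, T n (idx n x) := by simpa [Filter.Frequently] using hxT
      obtain ⟨n, hn, hTn⟩ := (frequently_atTop.1 hfreq) N
      exact Or.inr (Set.mem_iUnion.2 ⟨⟨(n, idx n x), hn, hTn⟩, ⟨hx, hfreq⟩, rfl⟩)
  refine (dimH_mono hsub).trans_lt ?_
  rw [dimH_union, dimH_countable h.countable, dimH_iUnion]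
  refine max_lt one_pos ((iSup_le fun p ↦ hcell _ _ p.2.1 p.2.2).trans_lt ?_)
  rwa [← ENNReal.ofReal_one, ENNReal.ofReal_lt_ofReal_iff one_pos]

end CellControl

end FuchsianLimit

namespace FuchsianLimit

open UpperHalfPlane Filter Topology
open scoped MatrixGroups ComplexConjugate

/-! ### Verification of the combinatorial control for the limit set of a net -/

/-- The point of the upper half plane above the midpoint of a dyadic interval, at height the
length of the interval. -/
noncomputable def pt (n : ℕ) (k : ℤ) : ℍ :=
  UpperHalfPlane.mk ⟨(k + 1 / 2) / 2 ^ n, (1 / 2) ^ n⟩ (by positivity)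

lemma pt_re (n : ℕ) (k : ℤ) : (pt n k).re = (k + 1 / 2) / 2 ^ n := rfl

lemma pt_im (n : ℕ) (k : ℤ) : (pt n k).im = (1 / 2) ^ n := rfl

lemma idx_eq_iff_abs_le {n : ℕ} {k : ℤ} {x : ℝ} (h : idx n x = k) :
    |(pt n k).re - x| ≤ (1 / 2) ^ n / 2 := by
  rw [idx_eq_iff, Set.mem_Ico] at h
  have e : (pt n k).re = k / 2 ^ n + (1 / 2) ^ n / 2 := by
    rw [pt_re, one_div_pow]; ring
  have e2 : ((k : ℝ) + 1) / 2 ^ n = k / 2 ^ n + (1 / 2) ^ n := by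
    rw [one_div_pow]; ring
  rw [e2] at h
  rw [e, abs_le]
  constructor <;> linarith

lemma idx_eq_of_abs_lt {n : ℕ} {k : ℤ} {x : ℝ} (h : |x - (pt n k).re| < (pt n k).im / 2) :
    idx n x = k := by
  rw [idx_eq_iff, Set.mem_Ico]
  have e : (pt n k).re = k / 2 ^ n + (1 / 2) ^ n / 2 := by
    rw [pt_re, one_div_pow]; ring
  have e2 : ((k : ℝ) + 1) / 2 ^ n = k / 2 ^ n + (1 / 2) ^ n := by
    rw [one_div_pow]; ring
  rw [e, pt_im, abs_lt] at h
  rw [e2]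
  constructor <;> linarith

lemma abs_sub_lt_of_idx_eq {n : ℕ} {x y : ℝ} (h : idx n x = idx n y) :
    |x - y| < (1 / 2) ^ n := by
  have h1 := idx_eq_iff.1 h
  have h2 := idx_eq_iff.1 (rfl : idx n y = _)
  have e2 : ((idx n y : ℝ) + 1) / 2 ^ n = idx n y / 2 ^ n + (1 / 2) ^ n := by
    rw [one_div_pow]; ring
  rw [Set.mem_Ico, e2] at h1 h2
  rw [abs_lt]
  constructor <;> linarith

lemma norm_pt_sub_le (n : ℕ) (x : ℝ) :
    ‖(pt n (idx n x) : ℂ) - x‖ ≤ 3 / 2 * (1 / 2) ^ n := by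
  have h1 := Complex.norm_le_abs_re_add_abs_im ((pt n (idx n x) : ℂ) - x)
  have h2 := idx_eq_iff_abs_le (rfl : idx n x = _)
  have h3 : |((pt n (idx n x) : ℂ) - x).im| = (1 / 2) ^ n := by
    simp only [Complex.sub_im, Complex.ofReal_im, sub_zero, coe_im, pt_im]
    exact abs_of_pos (by positivity)
  rw [h3] at h1
  simp only [Complex.sub_re, Complex.ofReal_re, coe_re] at h1
  linarith

lemma dist_pt_succ_le (n : ℕ) (x : ℝ) :
    dist (pt n (idx n x)) (pt (n + 1) (idx (n + 1) x)) ≤ 3 := by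
  set p := pt n (idx n x) with hp
  set p' := pt (n + 1) (idx (n + 1) x) with hp'
  have hc := cosh_dist p p'
  have h1 : ‖(p : ℂ) - p'‖ ≤ 9 / 4 * (1 / 2) ^ n := by
    have h2 := norm_pt_sub_le n x
    have h3 := norm_pt_sub_le (n + 1) x
    rw [pow_succ] at h3
    have h4 := norm_sub_le_norm_sub_add_norm_sub (p : ℂ) x p'
    rw [norm_sub_rev (x : ℂ)] at h4
    linarith
  have h2 : Real.cosh (dist p p') ≤ 7 := by
    rw [hc, Complex.dist_eq, show p.im = (1 / 2) ^ n from rfl,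
      show p'.im = (1 / 2) ^ (n + 1) from rfl]
    have hy : (0 : ℝ) < (1 / 2) ^ n := by positivity
    have h3 : ‖(p : ℂ) - p'‖ ^ 2 ≤ (9 / 4 * (1 / 2) ^ n) ^ 2 := by gcongr
    have h4 : ‖(p : ℂ) - p'‖ ^ 2 / (2 * (1 / 2) ^ n * (1 / 2) ^ (n + 1)) ≤ 6 := by
      rw [div_le_iff₀ (by positivity), pow_succ (1 / 2 : ℝ) n]
      nlinarith
    linarith
  by_contra! hlt
  have h3 := Real.exp_lt_exp.2 hlt
  have h4 : Real.exp 3 = Real.exp 1 ^ 3 := by rw [← Real.exp_nat_mul]; norm_num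
  have h5 : (2.7 : ℝ) ^ 3 ≤ Real.exp 1 ^ 3 := by
    have := Real.exp_one_gt_d9
    gcongr
    linarith
  have h6 := Real.exp_pos (-dist p p')
  rw [Real.cosh_eq] at h2
  norm_num at h5
  linarith

lemma dist_pt_add_le (n i : ℕ) (x : ℝ) :
    dist (pt n (idx n x)) (pt (n + i) (idx (n + i) x)) ≤ 3 * i := by
  induction i with
  | zero => simp
  | succ i ih =>
    have h1 := dist_pt_succ_le (n + i) x
    have h2 := dist_triangle (pt n (idx n x)) (pt (n + i) (idx (n + i) x))
      (pt (n + (i + 1)) (idx (n + (i + 1)) x))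
    push_cast
    rw [← add_assoc] at h2 ⊢
    linarith

lemma visible_pt {O : Set ℍ} {a x : ℝ} {n : ℕ} (ha : a ∈ limitSet O) (hx : x ∈ limitSet O)
    (hax : (1 / 2) ^ n ≤ |x - a|) : Visible O (pt n (idx n x)) := by
  set y : ℝ := (1 / 2) ^ n with hy
  have hy0 : 0 < y := by positivity
  obtain ⟨o, ho, hox⟩ := mem_limitSet_iff.1 hx (y / 10) (by positivity)
  obtain ⟨o', ho', hoa⟩ := mem_limitSet_iff.1 ha (y / 10) (by positivity)
  set p := pt n (idx n x) with hp
  have hpx : ‖(p : ℂ) - x‖ ≤ 3 / 2 * y := norm_pt_sub_le n x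
  have hxa : ‖(x : ℂ) - a‖ = |x - a| := by
    rw [← Complex.ofReal_sub, Complex.norm_real, Real.norm_eq_abs]
  refine ⟨o, ho, o', ho', ?_⟩
  rw [show p.im = y from rfl]
  have h1 : ‖(p : ℂ) - o‖ ≤ 1.6 * y := by
    have := norm_sub_le_norm_sub_add_norm_sub (p : ℂ) x o
    rw [norm_sub_rev (x : ℂ) o] at this
    linarith
  have h2 : ‖(p : ℂ) - o'‖ ≤ 1.6 * y + |x - a| := by
    have := norm_sub_le_norm_sub_add_norm_sub (p : ℂ) x o'
    have := norm_sub_le_norm_sub_add_norm_sub (x : ℂ) a o'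
    rw [norm_sub_rev (a : ℂ) o'] at this
    linarith
  have h3 : |x - a| - y / 5 ≤ ‖(o : ℂ) - o'‖ := by
    have := norm_sub_le_norm_sub_add_norm_sub (x : ℂ) o a
    have := norm_sub_le_norm_sub_add_norm_sub (o : ℂ) o' a
    rw [norm_sub_rev (x : ℂ) o] at *
    linarith
  calc ‖(p : ℂ) - o‖ * ‖(p : ℂ) - o'‖ ≤ 1.6 * y * (1.6 * y + |x - a|) := by gcongr
    _ ≤ 10 * (y * (|x - a| - y / 5)) := by nlinarith
    _ ≤ 10 * (y * ‖(o : ℂ) - o'‖) := by gcongr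

/-- A cell is marked when the associated point is close to the net. -/
def Thick (O : Set ℍ) (D : ℝ) (n : ℕ) (k : ℤ) : Prop := ∃ o ∈ O, dist (pt n k) o ≤ D

/-- Every unmarked cell of level at least `N` meeting the limit set lies deep in a cusp. -/
def CuspDichotomy (O : Set ℍ) (D : ℝ) (N : ℕ) : Prop :=
  ∀ x ∈ limitSet O, ∀ n, N ≤ n → ¬ Thick O D n (idx n x) →
    ∃ g l, CuspFrame O g l ∧ Real.exp 3 * (1 + l ^ 2) < (g • pt n (idx n x)).im

lemma exists_cuspDichotomy {O : Set ℍ} (h : IsNet O) (hL : ¬ (limitSet O).Subsingleton) :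
    ∃ D N, CuspDichotomy O D N := by
  obtain ⟨a, ha, b, hb, hab⟩ := Set.not_subsingleton_iff.1 hL
  obtain ⟨D, hD⟩ := thick_or_cusp h (Real.exp 3)
  have hpos : 0 < |a - b| / 2 := by have := abs_pos.2 (sub_ne_zero.2 hab); positivity
  obtain ⟨N, hN⟩ := exists_pow_lt_of_lt_one hpos (show (1 / 2 : ℝ) < 1 by norm_num)
  refine ⟨D, N, fun x hx n hn hT ↦ ?_⟩
  have hle : (1 / 2 : ℝ) ^ n ≤ (1 / 2) ^ N :=
    pow_le_pow_of_le_one (by norm_num) (by norm_num) hn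
  refine (hD _ ?_).resolve_left hT
  by_cases hxa : (1 / 2) ^ n ≤ |x - a|
  · exact visible_pt ha hx hxa
  · refine visible_pt hb hx ?_
    have := abs_sub_le a x b
    rw [abs_sub_comm a x] at this
    linarith

/-- Along consecutive unmarked cells the cusp does not change. -/
lemma CuspDichotomy.persist {O : Set ℍ} {D : ℝ} {N : ℕ} (h : CuspDichotomy O D N) {x : ℝ}
    (hx : x ∈ limitSet O) {n : ℕ} (hn : N ≤ n) {g : SL(2, ℝ)} {l : ℝ} (hg : CuspFrame O g l)
    (hgl : Real.exp 3 * (1 + l ^ 2) < (g • pt n (idx n x)).im) (i : ℕ)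
    (hT : ∀ i' ≤ i, ¬ Thick O D (n + i') (idx (n + i') x)) :
    1 < (g • pt (n + i) (idx (n + i) x)).im := by
  have h3 : 1 ≤ Real.exp 3 := Real.one_le_exp (by norm_num)
  suffices ∃ g' l', CuspFrame O g' l' ∧
      Real.exp 3 * (1 + l' ^ 2) < (g' • pt (n + i) (idx (n + i) x)).im ∧
      ∀ w : ℍ, (g' • w).im = (g • w).im by
    obtain ⟨g', l', -, h1, h2⟩ := this
    rw [← h2]
    nlinarith [sq_nonneg l']
  induction i with
  | zero => exact ⟨g, l, hg, hgl, fun _ ↦ rfl⟩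
  | succ i ih =>
    obtain ⟨g', l', hg', hgl', he⟩ := ih fun i' hi' ↦ hT i' (by omega)
    obtain ⟨g₂, l₂, hg₂, hgl₂⟩ := h x hx (n + (i + 1)) (by omega) (hT _ le_rfl)
    refine ⟨g₂, l₂, hg₂, hgl₂, fun w ↦ ?_⟩
    rw [← he]
    refine (hg'.im_eq hg₂ (p := pt (n + i) (idx (n + i) x)) ?_ ?_ w).symm
    · nlinarith [sq_nonneg l']
    · have h4 := im_le_im_mul_exp_dist (g₂ • pt (n + (i + 1)) (idx (n + (i + 1)) x))
        (g₂ • pt (n + i) (idx (n + i) x))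
      rw [dist_smul, dist_comm] at h4
      have h5 := Real.exp_le_exp.2 (dist_pt_succ_le (n + i) x)
      rw [← add_assoc] at hgl₂ h4
      set A := (g₂ • pt (n + i) (idx (n + i) x)).im with hA
      have hA0 : 0 < A := UpperHalfPlane.im_pos _
      by_contra! hle
      have h6 : Real.exp 3 ≤ Real.exp 3 * (1 + l₂ ^ 2) := by nlinarith [sq_nonneg l₂]
      have h7 : A * Real.exp (dist (pt (n + i) (idx (n + i) x))
        (pt (n + i + 1) (idx (n + i + 1) x))) ≤ 1 * Real.exp 3 := by gcongr
      linarith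

lemma norm_sq_lt_im_of_one_lt {g : SL(2, ℝ)} {w : ℍ} (h : 1 < (g • w).im) :
    ‖(g 1 0 * w + g 1 1 : ℂ)‖ ^ 2 < w.im := by
  have h0 : 0 < ‖(g 1 0 * w + g 1 1 : ℂ)‖ := norm_pos_iff.2 (den_ne_zero g w)
  rw [im_smul_eq, lt_div_iff₀ (by positivity)] at h
  linarith

lemma linear_eq_zero_of_persist {g : SL(2, ℝ)} {x : ℝ} {n : ℕ}
    (h : ∀ i, 1 < (g • pt (n + i) (idx (n + i) x)).im) : g 1 0 * x + g 1 1 = 0 := by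
  have hy : Tendsto (fun i : ℕ ↦ (1 / 2 : ℝ) ^ (n + i)) atTop (𝓝 0) :=
    (tendsto_pow_atTop_nhds_zero_of_lt_one (by norm_num) (by norm_num)).comp
      (tendsto_atTop_mono (fun t ↦ Nat.le_add_left t n) tendsto_id)
  have hpt : Tendsto (fun i ↦ (pt (n + i) (idx (n + i) x) : ℂ)) atTop (𝓝 (x : ℂ)) := by
    rw [tendsto_iff_norm_sub_tendsto_zero]
    refine squeeze_zero (fun _ ↦ norm_nonneg _) (fun i ↦ norm_pt_sub_le (n + i) x) ?_
    simpa using hy.const_mul (3 / 2)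
  have hlim : Tendsto (fun i ↦ ‖(g 1 0 * pt (n + i) (idx (n + i) x) + g 1 1 : ℂ)‖ ^ 2) atTop
      (𝓝 (‖(g 1 0 * x + g 1 1 : ℂ)‖ ^ 2)) :=
    (((hpt.const_mul _).add_const _).norm).pow 2
  have h0 := le_of_tendsto_of_tendsto hlim hy
    (Eventually.of_forall fun i ↦ (norm_sq_lt_im_of_one_lt (h i)).le)
  have h1 : ‖(g 1 0 * x + g 1 1 : ℂ)‖ = 0 := by
    have := norm_nonneg (g 1 0 * x + g 1 1 : ℂ)
    nlinarith
  exact_mod_cast norm_eq_zero.1 h1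

lemma CuspDichotomy.countable {O : Set ℍ} {D : ℝ} {N : ℕ} (h : CuspDichotomy O D N) :
    {x ∈ limitSet O | ∀ᶠ n in atTop, ¬ Thick O D n (idx n x)}.Countable := by
  set A : ℕ × ℤ → Set ℝ := fun p ↦ {x | x ∈ limitSet O ∧ idx (N + p.1) x = p.2 ∧
    ∀ i, ¬ Thick O D (N + p.1 + i) (idx (N + p.1 + i) x)} with hA
  have hsub : {x ∈ limitSet O | ∀ᶠ n in atTop, ¬ Thick O D n (idx n x)} ⊆ ⋃ p, A p := by
    rintro x ⟨hx, hev⟩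
    obtain ⟨n, hn⟩ := eventually_atTop.1 hev
    exact Set.mem_iUnion.2 ⟨(n, idx (N + n) x), hx, rfl, fun i ↦ hn _ (by omega)⟩
  refine (Set.countable_iUnion fun p ↦ Set.Subsingleton.countable ?_).mono hsub
  rintro x ⟨hx, hxk, hxT⟩ x' ⟨hx', hxk', hxT'⟩
  obtain ⟨g, l, hg, hgl⟩ := h x hx (N + p.1) (by omega) (hxT 0)
  have h1 := linear_eq_zero_of_persist fun i ↦
    h.persist hx (by omega) hg hgl i fun i' _ ↦ hxT i'
  have h2 := linear_eq_zero_of_persist fun i ↦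
    h.persist hx' (by omega) hg (by rwa [hxk', ← hxk]) i fun i' _ ↦ hxT' i'
  have hc : g 1 0 ≠ 0 := by
    intro hc
    have := det_eq_one g
    rw [hc, zero_mul, zero_add] at h1
    rw [hc, h1] at this
    simp at this
  exact mul_left_cancel₀ hc (by linarith)

lemma exists_gap_cell {O : Set ℍ} (h : IsNet O) (hne : limitSet O ≠ Set.univ) (D : ℝ) :
    ∃ m : ℕ, 1 ≤ m ∧ ∀ n k, Thick O D n k →
      ∃ k', (∀ x, idx (n + m) x = k' → idx n x = k) ∧ ∀ x ∈ limitSet O, idx (n + m) x ≠ k' := by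
  obtain ⟨δ, hδ, hgap⟩ := exists_gap h hne D
  obtain ⟨m, hm⟩ := exists_pow_lt_of_lt_one hδ (show (1 / 2 : ℝ) < 1 by norm_num)
  refine ⟨m + 1, by omega, fun n k hT ↦ ?_⟩
  obtain ⟨t, ht, hto⟩ := hgap _ hT
  have htk := idx_eq_of_abs_lt ht
  refine ⟨idx (n + (m + 1)) t, fun x hx ↦ (idx_congr (by omega) hx).trans htk, fun x hxL hx ↦ ?_⟩
  have h1 := abs_sub_lt_of_idx_eq hx
  have h2 : (1 / 2 : ℝ) ^ (n + (m + 1)) < δ * (1 / 2) ^ n := by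
    rw [pow_add, mul_comm, pow_succ]
    have : (0 : ℝ) < (1 / 2) ^ m := by positivity
    gcongr
    linarith
  obtain ⟨o, ho, hox⟩ := mem_limitSet_iff.1 hxL (δ * (1 / 2) ^ n - |x - t|) (by linarith)
  have h3 := hto o ho
  rw [pt_im] at h3
  have h4 := norm_sub_le_norm_sub_add_norm_sub (o : ℂ) x t
  rw [← Complex.ofReal_sub, Complex.norm_real, Real.norm_eq_abs] at h4
  linarith

lemma card_le_of_abs_sub_le {S : Finset ℤ} {W : ℝ} (hW : 0 ≤ W)
    (h : ∀ a ∈ S, ∀ b ∈ S, |(a : ℝ) - b| ≤ W) : (S.card : ℝ) ≤ W + 1 := by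
  rcases S.eq_empty_or_nonempty with rfl | hS
  · simp; linarith
  set a := S.min' hS with ha
  have hsub : S ⊆ Finset.Icc a (a + ⌊W⌋) := by
    intro b hb
    refine Finset.mem_Icc.2 ⟨S.min'_le b hb, ?_⟩
    have h1 := (le_abs_self _).trans (h b hb a (S.min'_mem hS))
    have : b - a ≤ ⌊W⌋ := Int.le_floor.2 (by push_cast; exact h1)
    linarith
  have h1 := Finset.card_le_card hsub
  have h0 : 0 ≤ ⌊W⌋ := Int.floor_nonneg.2 hW
  rw [Int.card_Icc] at h1
  have h2 : (S.card : ℤ) ≤ ⌊W⌋ + 1 := by omega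
  have h3 : (S.card : ℝ) ≤ (⌊W⌋ : ℝ) + 1 := by exact_mod_cast h2
  linarith [Int.floor_le W]

/-- Two points inside a horoball, at the same small height and below a common point which is not
deep inside the horoball, are close to each other. -/
lemma abs_re_sub_le {g : SL(2, ℝ)} {p₀ p p' : ℍ} {A : ℝ} (hp₀ : (g • p₀).im ≤ Real.exp (2 * A))
    (hp : 1 < (g • p).im) (hp' : 1 < (g • p').im) (him : p'.im = p.im)
    (hd : ‖(p₀ : ℂ) - p‖ ≤ 3 * p₀.im) (hsmall : 4 * Real.exp (2 * A) * p.im ≤ p₀.im) :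
    |p.re - p'.re| ≤ 12 * Real.exp A * (√p₀.im * √p.im) := by
  have h1 := norm_sq_lt_im_of_one_lt hp
  have h2 := norm_sq_lt_im_of_one_lt hp'
  rw [him] at h2
  set s := √p.im with hs
  set s₀ := √p₀.im with hs₀
  have hs2 : s ^ 2 = p.im := Real.sq_sqrt p.im_pos.le
  have hs02 : s₀ ^ 2 = p₀.im := Real.sq_sqrt p₀.im_pos.le
  have hspos : 0 < s := Real.sqrt_pos.2 p.im_pos
  have hs0pos : 0 < s₀ := Real.sqrt_pos.2 p₀.im_pos
  have hE : Real.exp (2 * A) = Real.exp A ^ 2 := by rw [← Real.exp_nat_mul]; norm_num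
  set E := Real.exp A with hEdef
  have hE0 : 0 < E := Real.exp_pos _
  rw [hE] at hp₀ hsmall
  set c := g 1 0 with hc
  set d := g 1 1 with hdd
  rw [← hs2] at h1 h2
  have h1' : ‖(c * p + d : ℂ)‖ ≤ s := (lt_of_pow_lt_pow_left₀ 2 hspos.le h1).le
  have h2' : ‖(c * p' + d : ℂ)‖ ≤ s := (lt_of_pow_lt_pow_left₀ 2 hspos.le h2).le
  have h0 : s₀ ≤ E * ‖(c * p₀ + d : ℂ)‖ := by
    have hpos : 0 < ‖(c * p₀ + d : ℂ)‖ := norm_pos_iff.2 (den_ne_zero g p₀)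
    rw [im_smul_eq, div_le_iff₀ (by positivity), ← hs02, ← mul_pow] at hp₀
    exact le_of_sq_le_sq hp₀ (by positivity)
  have hsm : 2 * E * s ≤ s₀ := by
    rw [← hs2, ← hs02] at hsmall
    exact le_of_sq_le_sq (by linarith) hs0pos.le
  have h3 : ‖(c * p₀ + d : ℂ)‖ ≤ s + |c| * (3 * s₀ ^ 2) := by
    have e : (c * p₀ + d : ℂ) = (c * p + d) + c * (p₀ - p) := by ring
    rw [e]
    refine (norm_add_le _ _).trans ?_
    rw [norm_mul, Complex.norm_real, Real.norm_eq_abs, hs02]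
    gcongr
  have h4 : |c| * |p.re - p'.re| ≤ 2 * s := by
    rw [← abs_mul]
    have e : c * (p.re - p'.re) = ((c * p + d : ℂ) - (c * p' + d)).re := by simp; ring
    rw [e]
    refine (Complex.abs_re_le_norm _).trans ((norm_sub_le _ _).trans (by linarith))
  have h5 : s₀ ≤ 6 * E * |c| * s₀ ^ 2 := by nlinarith
  have h6 : 1 ≤ 6 * E * |c| * s₀ := by
    by_contra! hlt
    nlinarith
  calc |p.re - p'.re| ≤ (6 * E * |c| * s₀) * |p.re - p'.re| :=
        le_mul_of_one_le_left (abs_nonneg _) h6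
    _ = 6 * E * s₀ * (|c| * |p.re - p'.re|) := by ring
    _ ≤ 6 * E * s₀ * (2 * s) := by gcongr
    _ = 12 * E * (s₀ * s) := by ring

lemma abs_idx_sub_le {O : Set ℍ} {D : ℝ} {N m : ℕ} (h : CuspDichotomy O D N)
    {n : ℕ} {k : ℤ} (hn : N ≤ n) (hT : Thick O D n k) {i : ℕ}
    (hi : 4 * Real.exp (D + 3 * m) ≤ 2 ^ i) {x x' : ℝ} (hx : x ∈ limitSet O)
    (hx' : x' ∈ limitSet O) (hxk : idx n x = k) (he : idx (n + m) x = idx (n + m) x')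
    (hxT : ∀ i' ≤ i, ¬ Thick O D (n + m + i') (idx (n + m + i') x))
    (hxT' : ∀ i' ≤ i, ¬ Thick O D (n + m + i') (idx (n + m + i') x')) :
    |(idx (n + m + i) x : ℝ) - idx (n + m + i) x'| ≤
      12 * Real.exp ((D + 3 * m) / 2) * (3 / 2) ^ i := by
  obtain ⟨g, l, hg, hgl⟩ := h x hx (n + m) (by omega) (hxT 0 (by omega))
  have hp := h.persist hx (by omega) hg hgl i hxT
  have hp' := h.persist hx' (by omega) hg (by rwa [← he]) i hxT'
  set p₀ := pt (n + m) (idx (n + m) x) with hp₀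
  set p := pt (n + m + i) (idx (n + m + i) x) with hpdef
  set p' := pt (n + m + i) (idx (n + m + i) x') with hpdef'
  have h0 : (g • p₀).im ≤ Real.exp (2 * ((D + 3 * m) / 2)) := by
    obtain ⟨o, ho, hko⟩ := hT
    have h1 := im_le_im_mul_exp_dist (g • p₀) (g • o)
    rw [dist_smul] at h1
    have h2 := dist_pt_add_le n m x
    rw [hxk, ← hp₀] at h2
    have h3 := dist_triangle p₀ (pt n k) o
    rw [dist_comm p₀ (pt n k)] at h3
    rw [mul_div_cancel₀ _ two_ne_zero]
    have h4 : Real.exp (dist p₀ o) ≤ Real.exp (D + 3 * m) := Real.exp_le_exp.2 (by linarith)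
    calc (g • p₀).im ≤ (g • o).im * Real.exp (dist p₀ o) := h1
      _ ≤ 1 * Real.exp (D + 3 * m) := by
        gcongr
        exact hg.le_one o ho
      _ = _ := one_mul _
  have hY : p.im = p₀.im * (1 / 2) ^ i := by
    change (1 / 2 : ℝ) ^ (n + m + i) = (1 / 2) ^ (n + m) * (1 / 2) ^ i
    rw [pow_add]
  have hY0 := p₀.im_pos
  have hle1 : (1 / 2 : ℝ) ^ i ≤ 1 := pow_le_one₀ (by norm_num) (by norm_num)
  have hd : ‖(p₀ : ℂ) - p‖ ≤ 3 * p₀.im := by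
    have h2 : ‖(p₀ : ℂ) - x‖ ≤ 3 / 2 * p₀.im := norm_pt_sub_le (n + m) x
    have h3 : ‖(p : ℂ) - x‖ ≤ 3 / 2 * p.im := norm_pt_sub_le (n + m + i) x
    have h4 := norm_sub_le_norm_sub_add_norm_sub (p₀ : ℂ) x p
    rw [norm_sub_rev (x : ℂ)] at h4
    have h5 : p.im ≤ p₀.im := by
      rw [hY]
      exact mul_le_of_le_one_right hY0.le hle1
    linarith
  have hsmall : 4 * Real.exp (2 * ((D + 3 * m) / 2)) * p.im ≤ p₀.im := by
    rw [mul_div_cancel₀ _ two_ne_zero, hY]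
    calc 4 * Real.exp (D + 3 * m) * (p₀.im * (1 / 2) ^ i) ≤ 2 ^ i * (p₀.im * (1 / 2) ^ i) := by
          gcongr
      _ = p₀.im := by rw [one_div_pow]; field_simp
  have key := abs_re_sub_le h0 hp hp' rfl hd hsmall
  have e : p.re - p'.re = ((idx (n + m + i) x : ℝ) - idx (n + m + i) x') * p.im := by
    rw [hpdef, hpdef', pt_re, pt_re, pt_im, one_div_pow]
    ring
  have hp0 := p.im_pos
  rw [e, abs_mul, abs_of_pos hp0] at key
  have hsq : √p₀.im ≤ (3 / 2) ^ i * √p.im := by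
    rw [hY, Real.sqrt_mul hY0.le]
    have h1 : 1 ≤ (3 / 2) ^ i * √((1 / 2 : ℝ) ^ i) := by
      rw [← abs_of_nonneg (show (0 : ℝ) ≤ (3 / 2) ^ i by positivity), ← Real.sqrt_sq_eq_abs,
        ← Real.sqrt_mul (by positivity), Real.one_le_sqrt, ← pow_mul, mul_comm i, pow_mul,
        ← mul_pow]
      exact one_le_pow₀ (by norm_num)
    nlinarith [Real.sqrt_nonneg p₀.im]
  have hss : √p.im * √p.im = p.im := Real.mul_self_sqrt hp0.le
  refine le_of_mul_le_mul_right (key.trans ?_) hp0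
  calc 12 * Real.exp ((D + 3 * m) / 2) * (√p₀.im * √p.im)
      ≤ 12 * Real.exp ((D + 3 * m) / 2) * ((3 / 2) ^ i * √p.im * √p.im) := by gcongr
    _ = 12 * Real.exp ((D + 3 * m) / 2) * (3 / 2) ^ i * p.im := by rw [mul_assoc _ √p.im, hss]; ring

lemma mem_Ico_of_idx_eq {n j : ℕ} {k k' : ℤ} {x : ℝ} (hx : idx n x = k)
    (hx' : idx (n + j) x = k') : k' ∈ Finset.Ico (k * 2 ^ j) ((k + 1) * 2 ^ j) := by
  have h1 := idx_eq_idx_div n j x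
  rw [hx, hx'] at h1
  have hpos : (0 : ℤ) < (2 ^ j : ℕ) := by positivity
  have h2 := Int.ediv_mul_le k' hpos.ne'
  have h3 := Int.lt_ediv_add_one_mul_self k' hpos
  rw [← h1] at h2 h3
  push_cast at h2 h3
  exact Finset.mem_Ico.2 ⟨h2, h3⟩

lemma card_Ico_cells (k : ℤ) (j : ℕ) : (Finset.Ico (k * 2 ^ j) ((k + 1) * 2 ^ j)).card = 2 ^ j := by
  rw [Int.card_Ico, add_mul, one_mul, add_sub_cancel_left]
  exact_mod_cast Int.toNat_natCast (2 ^ j)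

lemma CuspDichotomy.exists_count {O : Set ℍ} {D : ℝ} {N : ℕ} (h : CuspDichotomy O D N)
    (m : ℕ) : ∃ C : ℝ, 0 ≤ C ∧ ∀ n k, N ≤ n → Thick O D n k → ∀ j, m ≤ j → ∀ S : Finset ℤ,
    (∀ k' ∈ S, ∃ x ∈ limitSet O, idx n x = k ∧ idx (n + j) x = k' ∧
      ∀ i, m ≤ i → i < j → ¬ Thick O D (n + i) (idx (n + i) x)) →
      (S.card : ℝ) ≤ C * (3 / 2) ^ j := by
  obtain ⟨M, hM⟩ := pow_unbounded_of_one_lt (4 * Real.exp (D + 3 * m)) (one_lt_two (α := ℝ))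
  set B := 12 * Real.exp ((D + 3 * m) / 2) with hB
  have hB0 : 0 ≤ B := by positivity
  refine ⟨2 ^ (m + 1 + M) + 2 ^ m * (2 * B + 2), by positivity, fun n k hn hT j hj S hS ↦ ?_⟩
  have hone : (1 : ℝ) ≤ (3 / 2) ^ j := one_le_pow₀ (by norm_num)
  choose! x hxL hxk hxj hxT using hS
  rcases le_or_gt j (m + 1 + M) with hle | hlt
  · have hsub : S ⊆ Finset.Ico (k * 2 ^ j) ((k + 1) * 2 ^ j) := fun k' hk' ↦
      mem_Ico_of_idx_eq (hxk k' hk') (hxj k' hk')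
    have hcard := Finset.card_le_card hsub
    rw [card_Ico_cells] at hcard
    have hcard' : (S.card : ℝ) ≤ 2 ^ j := by exact_mod_cast hcard
    have hpow : (2 : ℝ) ^ j ≤ 2 ^ (m + 1 + M) := pow_le_pow_right₀ (by norm_num) hle
    have : (0 : ℝ) ≤ 2 ^ m * (2 * B + 2) := by positivity
    have : (0 : ℝ) ≤ 2 ^ (m + 1 + M) := by positivity
    nlinarith
  obtain ⟨i, rfl⟩ : ∃ i, j = m + i + 1 := ⟨j - m - 1, by omega⟩
  have hi : 4 * Real.exp (D + 3 * m) ≤ 2 ^ i :=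
    hM.le.trans (pow_le_pow_right₀ (by norm_num) (by omega))
  set f : ℤ → ℤ := fun k' ↦ idx (n + m) (x k') with hf
  have hfib : ∀ a ∈ S.image f, ((S.filter (f · = a)).card : ℝ) ≤
      (2 * B + 2) * (3 / 2) ^ (m + i + 1) := by
    intro a _
    have hpow : (3 / 2 : ℝ) ^ i ≤ (3 / 2) ^ (m + i + 1) :=
      pow_le_pow_right₀ (by norm_num) (by omega)
    refine (card_le_of_abs_sub_le (W := 2 * (B * (3 / 2) ^ i) + 1) (by positivity) ?_).trans ?_
    · intro k₁ hk₁ k₂ hk₂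
      rw [Finset.mem_filter] at hk₁ hk₂
      have hT' : ∀ k' ∈ S, ∀ i' ≤ i, ¬ Thick O D (n + m + i') (idx (n + m + i') (x k')) := by
        intro k' hk' i' hi'
        have := hxT k' hk' (m + i') (by omega) (by omega)
        rwa [← add_assoc] at this
      have key := abs_idx_sub_le h hn hT hi (hxL k₁ hk₁.1) (hxL k₂ hk₂.1) (hxk k₁ hk₁.1)
        (hk₁.2.trans hk₂.2.symm) (hT' k₁ hk₁.1) (hT' k₂ hk₂.1)
      have hhalf : ∀ k' ∈ S, idx (n + m + i) (x k') = k' / 2 := by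
        intro k' hk'
        rw [idx_eq_idx_div (n + m + i) 1, show n + m + i + 1 = n + (m + i + 1) by omega,
          hxj k' hk']
        norm_num
      rw [hhalf k₁ hk₁.1, hhalf k₂ hk₂.1] at key
      have e1 : ((k₁ : ℤ) : ℝ) = 2 * ((k₁ / 2 : ℤ) : ℝ) + ((k₁ % 2 : ℤ) : ℝ) := by
        exact_mod_cast (Int.mul_ediv_add_emod k₁ 2).symm
      have e2 : ((k₂ : ℤ) : ℝ) = 2 * ((k₂ / 2 : ℤ) : ℝ) + ((k₂ % 2 : ℤ) : ℝ) := by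
        exact_mod_cast (Int.mul_ediv_add_emod k₂ 2).symm
      have hr : |((k₁ % 2 : ℤ) : ℝ) - ((k₂ % 2 : ℤ) : ℝ)| ≤ 1 := by
        have : |k₁ % 2 - k₂ % 2| ≤ 1 := by rw [abs_le]; omega
        exact_mod_cast this
      rw [abs_le] at key hr ⊢
      rw [e1, e2]
      constructor <;> linarith [key.1, key.2, hr.1, hr.2]
    · nlinarith
  have himg : ((S.image f).card : ℝ) ≤ 2 ^ m := by
    have hsub : S.image f ⊆ Finset.Ico (k * 2 ^ m) ((k + 1) * 2 ^ m) := by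
      intro a ha
      obtain ⟨k', hk', rfl⟩ := Finset.mem_image.1 ha
      exact mem_Ico_of_idx_eq (hxk k' hk') rfl
    have := Finset.card_le_card hsub
    rw [card_Ico_cells] at this
    exact_mod_cast this
  calc (S.card : ℝ) = ∑ a ∈ S.image f, ((S.filter (f · = a)).card : ℝ) := by
        rw [Finset.card_eq_sum_card_image f S]
        push_cast
        rfl
    _ ≤ (S.image f).card • ((2 * B + 2) * (3 / 2) ^ (m + i + 1)) :=
        Finset.sum_le_card_nsmul _ _ _ hfib
    _ ≤ 2 ^ m * ((2 * B + 2) * (3 / 2) ^ (m + i + 1)) := by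
        rw [nsmul_eq_mul]
        gcongr
    _ ≤ (2 ^ (m + 1 + M) + 2 ^ m * (2 * B + 2)) * (3 / 2) ^ (m + i + 1) := by
        have : (0 : ℝ) ≤ 2 ^ (m + 1 + M) * (3 / 2) ^ (m + i + 1) := by positivity
        linarith

/-- The limit set of a net which is not the whole line has Hausdorff dimension less than one. -/
theorem IsNet.dimH_limitSet_lt_one {O : Set ℍ} (h : IsNet O) (hne : limitSet O ≠ Set.univ) :
    dimH (limitSet O) < 1 := by
  by_cases hL : (limitSet O).Subsingleton
  · rw [dimH_subsingleton hL]
    exact one_pos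
  obtain ⟨D, N, hDN⟩ := exists_cuspDichotomy h hL
  obtain ⟨m, hm, hgap⟩ := exists_gap_cell h hne D
  obtain ⟨C, hC, hcount⟩ := hDN.exists_count m
  exact CellControl.dimH_lt_one (T := Thick O D) (N := N) (m := m) (C := C)
    { one_le := hm
      nonneg := hC
      gap := fun n k _ hT ↦ hgap n k hT
      count := hcount
      countable := hDN.countable }

/-! ### Isometries of the hyperbolic plane and orbits -/

lemma norm_coe_sub_sq (v w : ℍ) :
    dist (v : ℂ) w ^ 2 = (v.re - w.re) ^ 2 + (v.im - w.im) ^ 2 := by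
  rw [Complex.dist_eq, ← Complex.normSq_eq_norm_sq, Complex.normSq_apply]
  simp [sq]

lemma sq_mul_im_eq_of_dist_eq {v w a b : ℍ} (h : dist v a = dist w b) :
    ((v.re - a.re) ^ 2 + (v.im - a.im) ^ 2) * (w.im * b.im) =
      ((w.re - b.re) ^ 2 + (w.im - b.im) ^ 2) * (v.im * a.im) := by
  have h1 := cosh_dist v a
  have hw := cosh_dist w b
  rw [h, hw, norm_coe_sub_sq, norm_coe_sub_sq] at h1
  have := v.im_pos
  have := w.im_pos
  have := a.im_pos
  have := b.im_pos
  field_simp at h1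
  linarith

lemma eq_or_eq_mirror {v w J : ℍ} (hJr : J.re = 0) (hJi : J.im = 2) (hI : dist v I = dist w I)
    (hJ : dist v J = dist w J) : v = w ∨ v = mirror w := by
  have h1 := sq_mul_im_eq_of_dist_eq hI
  have h2 := sq_mul_im_eq_of_dist_eq hJ
  simp only [I_re, I_im, hJr, hJi] at h1 h2
  have him : v.im = w.im := by nlinarith
  have hw := w.im_pos
  rw [him] at h1
  have h3 : v.re ^ 2 = w.re ^ 2 := by
    have := mul_right_cancel₀ (by positivity) h1
    linarith
  rcases sq_eq_sq_iff_eq_or_eq_neg.1 h3 with h4 | h4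
  · exact Or.inl (UpperHalfPlane.ext_re_im h4 him)
  · exact Or.inr (UpperHalfPlane.ext_re_im (by simpa using h4) (by simpa using him))

lemma eq_mirror_of_re_eq_zero {w : ℍ} (h : w.re = 0) : mirror w = w :=
  UpperHalfPlane.ext_re_im (by simp [h]) (by simp)

/-- A distance preserving map fixing `i` and `2i` is the identity or the reflection. -/
lemma eq_id_or_eq_mirror {ψ : ℍ → ℍ} (hψ : Isometry ψ) {J : ℍ} (hJr : J.re = 0) (hJi : J.im = 2)
    (hI : ψ I = I) (hJ : ψ J = J) : (∀ w, ψ w = w) ∨ ∀ w, ψ w = mirror w := by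
  have hor : ∀ w, ψ w = w ∨ ψ w = mirror w := fun w ↦
    eq_or_eq_mirror hJr hJi (by rw [← hψ.dist_eq w I, hI]) (by rw [← hψ.dist_eq w J, hJ])
  set u : ℍ := ⟨⟨1, 1⟩, one_pos⟩ with hu
  have hur : u.re = 1 := rfl
  have hui : u.im = 1 := rfl
  rcases hor u with hψu | hψu
  · left
    intro w
    refine (hor w).elim id fun hw ↦ ?_
    have h1 := sq_mul_im_eq_of_dist_eq (hψ.dist_eq w u)
    rw [hψu, hw, hur, hui, mirror_re, mirror_im] at h1
    have h2 := mul_right_cancel₀ (by have := w.im_pos; positivity) h1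
    rw [hw, eq_mirror_of_re_eq_zero (by linarith)]
  · right
    intro w
    refine (hor w).elim (fun hw ↦ ?_) id
    have h1 := sq_mul_im_eq_of_dist_eq (hψ.dist_eq w u)
    rw [hψu, hw, mirror_re, mirror_im, hur, hui] at h1
    have h2 := mul_right_cancel₀ (by have := w.im_pos; positivity) h1
    rw [hw, eq_mirror_of_re_eq_zero (by linarith)]

/-- Every isometry of the hyperbolic plane is a Möbius map, up to a reflection. -/
theorem exists_smul_or_smul_mirror (φ : ℍ ≃ᵢ ℍ) :
    ∃ g : SL(2, ℝ), (∀ w, φ w = g • w) ∨ ∀ w, φ w = g • mirror w := by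
  set J : ℍ := ⟨⟨0, 2⟩, two_pos⟩ with hJdef
  have hJr : J.re = 0 := rfl
  have hJi : J.im = 2 := rfl
  obtain ⟨k, hk, hre, him⟩ := exists_rotation_smul_re_eq_zero ((φ I).toSL2R⁻¹ • φ J)
  set f := k * (φ I).toSL2R⁻¹ with hf
  rw [← mul_smul, ← hf] at hre him
  have hψ : Isometry fun w ↦ f • φ w :=
    Isometry.of_dist_eq fun v w ↦ by rw [dist_smul, φ.dist_eq]
  have hI : f • φ I = I := by rw [hf, mul_smul, toSL2R_inv_smul_self, hk]
  have hJ : f • φ J = J := by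
    have h1 := sq_mul_im_eq_of_dist_eq (hψ.dist_eq J I)
    simp only [hI, hre, hJr, hJi, I_re, I_im] at h1
    refine UpperHalfPlane.ext_re_im (by rw [hre, hJr]) ?_
    rw [hJi]
    have h2 : (2 * (f • φ J).im - 1) * ((f • φ J).im - 2) = 0 := by linarith
    rcases mul_eq_zero.1 h2 with h3 | h3 <;> linarith
  refine ⟨f⁻¹, (eq_id_or_eq_mirror hψ hJr hJi hI hJ).imp ?_ ?_⟩ <;>
  · intro h w
    rw [eq_inv_smul_iff]
    exact h w

/-- The action of `φ` is that of an element of `SL(2, ℝ)`. -/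
def IsMoebius (φ : ℍ ≃ᵢ ℍ) : Prop := ∃ g : SL(2, ℝ), ∀ w, φ w = g • w

lemma IsMoebius.mul {φ ψ : ℍ ≃ᵢ ℍ} (hφ : IsMoebius φ) (hψ : IsMoebius ψ) :
    IsMoebius (φ * ψ) := by
  obtain ⟨g, hg⟩ := hφ
  obtain ⟨g', hg'⟩ := hψ
  exact ⟨g * g', fun w ↦ by rw [IsometryEquiv.mul_apply, hg', hg, mul_smul]⟩

lemma IsMoebius.inv {φ : ℍ ≃ᵢ ℍ} (hφ : IsMoebius φ) : IsMoebius φ⁻¹ := by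
  obtain ⟨g, hg⟩ := hφ
  refine ⟨g⁻¹, fun w ↦ ?_⟩
  rw [eq_inv_smul_iff, ← hg, IsometryEquiv.apply_inv_self]

lemma isMoebius_mul_of_not {φ ψ : ℍ ≃ᵢ ℍ} (hφ : ¬ IsMoebius φ) (hψ : ¬ IsMoebius ψ) :
    IsMoebius (φ * ψ) := by
  obtain ⟨g, hg⟩ := exists_smul_or_smul_mirror φ
  obtain ⟨g', hg'⟩ := exists_smul_or_smul_mirror ψ
  have hg := hg.resolve_left fun h ↦ hφ ⟨g, h⟩
  have hg' := hg'.resolve_left fun h ↦ hψ ⟨g', h⟩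
  refine ⟨g * mirrorConj g', fun w ↦ ?_⟩
  rw [IsometryEquiv.mul_apply, hg', hg, mirror_smul, mirror_mirror, mul_smul]

/-- The orbit of `z` under the group `Γ`. -/
def orbit (Γ : Subgroup (ℍ ≃ᵢ ℍ)) (z : ℍ) : Set ℍ := {w | ∃ γ ∈ Γ, γ z = w}

/-- The orbit of `z` under the orientation preserving elements of `Γ`. -/
def moebiusOrbit (Γ : Subgroup (ℍ ≃ᵢ ℍ)) (z : ℍ) : Set ℍ := {w | ∃ γ ∈ Γ, IsMoebius γ ∧ γ z = w}

lemma moebiusOrbit_subset (Γ : Subgroup (ℍ ≃ᵢ ℍ)) (z : ℍ) : moebiusOrbit Γ z ⊆ orbit Γ z :=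
  fun _ ⟨γ, hγ, _, h⟩ ↦ ⟨γ, hγ, h⟩

lemma exists_dist_moebiusOrbit_le (Γ : Subgroup (ℍ ≃ᵢ ℍ)) (z : ℍ) :
    ∃ d, 0 ≤ d ∧ ∀ w ∈ orbit Γ z, ∃ w' ∈ moebiusOrbit Γ z, dist w w' ≤ d := by
  by_cases h : ∀ γ ∈ Γ, IsMoebius γ
  · exact ⟨0, le_rfl, fun w ⟨γ, hγ, hw⟩ ↦ ⟨w, ⟨γ, hγ, h γ hγ, hw⟩, by simp⟩⟩
  push Not at h
  obtain ⟨ρ, hρ, hρM⟩ := h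
  refine ⟨dist z (ρ z), dist_nonneg, ?_⟩
  rintro _ ⟨γ, hγ, rfl⟩
  by_cases hM : IsMoebius γ
  · exact ⟨γ z, ⟨γ, hγ, hM, rfl⟩, by simp⟩
  · exact ⟨(γ * ρ) z, ⟨_, Γ.mul_mem hγ hρ, isMoebius_mul_of_not hM hρM, rfl⟩, by
      rw [IsometryEquiv.mul_apply, γ.dist_eq]⟩

lemma chainConnected_orbit (Γ : Subgroup (ℍ ≃ᵢ ℍ)) (hfg : Group.FG Γ) (z : ℍ) :
    ∃ R, ChainConnected R (orbit Γ z) := by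
  obtain ⟨S, hS⟩ := (Group.fg_def.1 hfg)
  obtain ⟨R, hR⟩ := (S.image fun s : Γ ↦ dist ((s : ℍ ≃ᵢ ℍ) z) z).bddAbove
  refine ⟨R, fun U hne hU ↦ ?_⟩
  obtain ⟨_, ⟨γ₀, hγ₀, rfl⟩, hγ₀U⟩ := hne
  have key : ∀ δ : Γ, ∀ γ : Γ, ((γ : ℍ ≃ᵢ ℍ) z ∈ U ↔ ((γ * δ : Γ) : ℍ ≃ᵢ ℍ) z ∈ U) := by
    intro δ
    have hδ : δ ∈ Subgroup.closure (S : Set Γ) := by rw [hS]; trivial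
    induction hδ using Subgroup.closure_induction with
    | mem s hs =>
      intro γ
      have hd : dist ((γ : ℍ ≃ᵢ ℍ) z) (((γ * s : Γ) : ℍ ≃ᵢ ℍ) z) ≤ R := by
        rw [Subgroup.coe_mul, IsometryEquiv.mul_apply, IsometryEquiv.dist_eq, dist_comm]
        exact hR (by
          rw [Finset.coe_image]
          exact ⟨s, hs, rfl⟩)
      constructor
      · exact fun h ↦ hU _ ⟨γ, γ.2, rfl⟩ h _ ⟨_, (γ * s).2, rfl⟩ hd
      · exact fun h ↦ hU _ ⟨_, (γ * s).2, rfl⟩ h _ ⟨γ, γ.2, rfl⟩ (by rwa [dist_comm])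
    | one => intro γ; rw [mul_one]
    | mul a b _ _ ha hb => intro γ; rw [ha γ, hb (γ * a), mul_assoc]
    | inv a _ ha => intro γ; rw [ha (γ * a⁻¹), inv_mul_cancel_right]
  rintro _ ⟨γ, hγ, rfl⟩
  have := (key (⟨γ₀, hγ₀⟩⁻¹ * ⟨γ, hγ⟩) ⟨γ₀, hγ₀⟩).1 hγ₀U
  rwa [mul_inv_cancel_left] at this

lemma isNet_moebiusOrbit (Γ : Subgroup (ℍ ≃ᵢ ℍ)) (hfg : Group.FG Γ) (z : ℍ)
    (hfin : ∀ p r, (orbit Γ z ∩ Metric.closedBall p r).Finite) :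
    IsNet (moebiusOrbit Γ z) where
  nonempty := ⟨z, 1, Γ.one_mem, ⟨1, fun w ↦ by simp⟩, rfl⟩
  transitive := by
    rintro _ ⟨γ, hγ, hM, rfl⟩ _ ⟨γ', hγ', hM', rfl⟩
    have hδ : γ' * γ⁻¹ ∈ Γ := Γ.mul_mem hγ' (Γ.inv_mem hγ)
    have hδM := hM'.mul hM.inv
    have ⟨g, hg⟩ := hδM
    refine ⟨g, fun w ↦ ⟨?_, ?_⟩, ?_⟩
    · rintro ⟨η, hη, hηM, hw⟩
      refine ⟨(γ' * γ⁻¹)⁻¹ * η, Γ.mul_mem (Γ.inv_mem hδ) hη, hδM.inv.mul hηM, ?_⟩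
      rw [IsometryEquiv.mul_apply, hw, ← hg, IsometryEquiv.inv_apply_self]
    · rintro ⟨η, hη, hηM, rfl⟩
      exact ⟨γ' * γ⁻¹ * η, Γ.mul_mem hδ hη, hδM.mul hηM, by rw [← hg]; rfl⟩
    · rw [← hg, IsometryEquiv.mul_apply, IsometryEquiv.inv_apply_self]
  finite p r := (hfin p r).subset (Set.inter_subset_inter_left _ (moebiusOrbit_subset Γ z))
  connected := by
    obtain ⟨R, hR⟩ := chainConnected_orbit Γ hfg z
    obtain ⟨d, hd0, hd⟩ := exists_dist_moebiusOrbit_le Γ z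
    refine ⟨R + 2 * d + |R|, fun U hne hU ↦ ?_⟩
    have hsub := hR {w | ∃ u ∈ moebiusOrbit Γ z ∩ U, dist w u ≤ d} ?_ ?_
    · intro o ho
      obtain ⟨u, hu, hou⟩ := hsub (moebiusOrbit_subset Γ z ho)
      refine hU u hu.1 hu.2 o ho ?_
      rw [dist_comm]
      linarith [neg_abs_le R]
    · obtain ⟨u, hu⟩ := hne
      exact ⟨u, moebiusOrbit_subset Γ z hu.1, u, hu, by simpa using hd0⟩
    · rintro a - ⟨u, hu, hau⟩ b hb hab
      obtain ⟨v, hv, hbv⟩ := hd b hb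
      refine ⟨v, ⟨hv, hU u hu.1 hu.2 v hv ?_⟩, hbv⟩
      have h1 := dist_triangle4 u a b v
      rw [dist_comm u a] at h1
      linarith [abs_nonneg R]

lemma limitSet_moebiusOrbit (Γ : Subgroup (ℍ ≃ᵢ ℍ)) (z : ℍ) :
    limitSet (moebiusOrbit Γ z) = limitSet (orbit Γ z) := by
  refine Set.Subset.antisymm
    (fun x hx ↦ closure_mono (Set.image_mono (moebiusOrbit_subset Γ z)) hx) fun x hx ↦ ?_
  obtain ⟨d, -, hd⟩ := exists_dist_moebiusOrbit_le Γ z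
  rw [mem_limitSet_iff] at hx ⊢
  intro e he
  obtain ⟨o, ho, hox⟩ := hx (e / Real.exp d) (by positivity)
  obtain ⟨v, hv, hov⟩ := hd o ho
  refine ⟨v, hv, ?_⟩
  have h1 := dist_coe_le v o
  have him : o.im ≤ ‖(o : ℂ) - x‖ := by
    have := Complex.abs_im_le_norm ((o : ℂ) - x)
    simp only [Complex.sub_im, Complex.ofReal_im, sub_zero, coe_im] at this
    exact (le_abs_self _).trans this
  have h2 := norm_sub_le_norm_sub_add_norm_sub (v : ℂ) o x
  rw [Complex.dist_eq, dist_comm v o] at h1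
  have h3 : Real.exp (dist o v) ≤ Real.exp d := Real.exp_le_exp.2 hov
  have h4 : 0 ≤ Real.exp (dist o v) - 1 := by
    have := Real.one_le_exp (dist_nonneg (x := o) (y := v))
    linarith
  rw [lt_div_iff₀ (Real.exp_pos d)] at hox
  nlinarith [norm_nonneg ((o : ℂ) - x)]

lemma finite_orbit_inter_closedBall {O : Set ℍ}
    (hdisc : ∀ c : ℂ, 0 < c.im → ¬ AccPt c (Filter.principal ((↑) '' O : Set ℂ))) (p : ℍ)
    (r : ℝ) : (O ∩ Metric.closedBall p r).Finite := by
  by_contra hinf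
  have hinf' : ((↑) '' (O ∩ Metric.closedBall p r) : Set ℂ).Infinite :=
    Set.Infinite.image UpperHalfPlane.coe_injective.injOn hinf
  have hcpt : IsCompact ((↑) '' Metric.closedBall p r : Set ℂ) :=
    (isCompact_closedBall p r).image UpperHalfPlane.continuous_coe
  obtain ⟨c, ⟨w, -, rfl⟩, hc⟩ := hinf'.exists_accPt_of_subset_isCompact hcpt
    (Set.image_mono Set.inter_subset_right)
  exact hdisc w w.im_pos (hc.mono (Filter.principal_mono.2 (Set.image_mono Set.inter_subset_left)))

end FuchsianLimit

open UpperHalfPlane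

/-!
STATEMENT 4: the limit set of a finitely generated Fuchsian group of the second kind has
Hausdorff dimension strictly less than 1; in particular its Lebesgue measure in
`∂_∞H² = S¹` is zero.  Here `Γ` is a discrete (its orbits have no accumulation point in
the open upper half plane) finitely generated subgroup of `Isom(H²)`, `O` is the orbit
of a point `z`, and `L` is the part of its limit set in `ℝ ⊂ ∂_∞H²`; the second-kind
hypothesis says the limit set is not all of the circle at infinity, which (since limit
sets are closed) is equivalent to `L ≠ ℝ`.
-/
theorem limit_set_dimH_lt_one (Γ : Subgroup (ℍ ≃ᵢ ℍ)) (hfg : Group.FG Γ) (z : ℍ)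
    (O : Set ℂ) (hO : O = {c : ℂ | ∃ γ : Γ, c = ((γ : ℍ ≃ᵢ ℍ) z : ℂ)})
    (hdisc : ∀ c : ℂ, 0 < c.im → ¬ AccPt c (Filter.principal O))
    (L : Set ℝ) (hL : L = {x : ℝ | (x : ℂ) ∈ closure O})
    (hsecond : L ≠ Set.univ) :
    dimH L < 1 ∧ MeasureTheory.volume L = 0 := by
  have hO' : O = ((↑) '' FuchsianLimit.orbit Γ z : Set ℂ) := by
    rw [hO]
    ext c
    constructor
    · rintro ⟨γ, rfl⟩
      exact ⟨_, ⟨γ, γ.2, rfl⟩, rfl⟩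
    · rintro ⟨_, ⟨γ, hγ, rfl⟩, rfl⟩
      exact ⟨⟨γ, hγ⟩, rfl⟩
  rw [hO'] at hdisc hL
  have hLeq : L = FuchsianLimit.limitSet (FuchsianLimit.moebiusOrbit Γ z) := by
    rw [hL, FuchsianLimit.limitSet_moebiusOrbit]
    rfl
  have hnet := FuchsianLimit.isNet_moebiusOrbit Γ hfg z
    (FuchsianLimit.finite_orbit_inter_closedBall hdisc)
  have hdim : dimH L < 1 := by
    rw [hLeq] at hsecond ⊢
    exact hnet.dimH_limitSet_lt_one hsecond
  refine ⟨hdim, ?_⟩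
  have h1 := hausdorffMeasure_of_dimH_lt (d := 1) (by simpa using hdim)
  rwa [NNReal.coe_one, MeasureTheory.hausdorffMeasure_real] at h1
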